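/- arXiv:math/0507154 — 6 statements merged into one kernel-verified Lean document; each statement's English description precedes it below -/
import Mathlib

section
/- Let k be a field of characteristic zero and let G be a finite subgroup of GL_2(k). Then for any faithful finite-dimensional linear representation V of G over k, the field of invariants k(V)^G is stably pure over k. -/
open MvPolynomial

set_option synthInstance.maxHeartbeats 1000000
set_option maxHeartbeats 1000000

section
variable {k L : Type*} [Field k] [Field L] [Algebra k L]

theorem algebraicIndependent_of_card_le {ι κ : Type*} [Finite ι] [Finite κ] {x : ι → L} {y : κ → L}
    (hx : AlgebraicIndependent k x) (hcard : Nat.card κ ≤ Nat.card ι)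
    (hy : Algebra.IsAlgebraic (IntermediateField.adjoin k (Set.range y)) L) :
    AlgebraicIndependent k y := by
  have := IntermediateField.isAlgebraic_adjoin_iff_top.1 hy
  refine (Algebra.IsAlgebraic.isTranscendenceBasis_of_lift_le_trdeg_of_finite k y ?_).1
  have := Fintype.ofFinite ι
  have := Fintype.ofFinite κ
  have h := hx.lift_cardinalMk_le_trdeg
  rw [← Nat.cast_card, Cardinal.lift_natCast, Cardinal.nat_le_lift_iff] at h ⊢
  exact (Nat.cast_le.2 hcard).trans h

theorem apply_mem_adjoin {S : Set L} {M : IntermediateField k L} (g : L ≃ₐ[k] L)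
    (h : ∀ s ∈ S, g s ∈ M) {x : L} (hx : x ∈ IntermediateField.adjoin k S) : g x ∈ M := by
  have : IntermediateField.adjoin k S ≤ M.comap (g : L →ₐ[k] L) :=
    IntermediateField.adjoin_le_iff.2 h
  exact this hx

theorem span_le_adjoin (S : Set L) :
    Submodule.span k S ≤ (IntermediateField.adjoin k S).toSubalgebra.toSubmodule :=
  Submodule.span_le.2 (IntermediateField.subset_adjoin k S)

theorem exists_eq_adjoin_of_le_adjoin_simple {s : L} (hs : Transcendental k s)
    {E : IntermediateField k L} (hE : E ≤ IntermediateField.adjoin k {s}) :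
    ∃ u, E = IntermediateField.adjoin k {u} := by
  let j : RatFunc k →ₐ[k] L :=
    (IntermediateField.adjoin k {s}).val.comp (RatFunc.algEquivOfTranscendental s hs).toAlgHom
  have hj : E ≤ j.fieldRange := fun a ha =>
    ⟨(RatFunc.algEquivOfTranscendental s hs).symm ⟨a, hE ha⟩, by simp [j]⟩
  refine ⟨j (RatFunc.Luroth.generator (E.comap j)), ?_⟩
  have h : (E.comap j).map j = E := by
    ext a
    constructor
    · rintro ⟨b, hb, rfl⟩; exact hb
    · intro ha
      obtain ⟨b, rfl⟩ := hj ha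
      exact ⟨b, ha, rfl⟩
  conv_lhs => rw [← h, RatFunc.Luroth.eq_adjoin_generator (E := E.comap j),
    IntermediateField.adjoin_map, Set.image_singleton]

variable (Γ : Subgroup (L ≃ₐ[k] L)) [Finite Γ]

theorem isIntegral_of_stable {M F : IntermediateField k L} (hM : ∀ g ∈ Γ, ∀ x ∈ M, g x ∈ M)
    (hMF : M ⊓ IntermediateField.fixedField Γ ≤ F) {x : L} (hx : x ∈ M) : IsIntegral F x := by
  have := Fintype.ofFinite Γ
  let p : Polynomial L := ∏ g : Γ, (Polynomial.X - Polynomial.C (g.1 x))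
  have hp : p.Monic := Polynomial.monic_prod_of_monic _ _ fun _ _ => Polynomial.monic_X_sub_C _
  have hpM : p ∈ Polynomial.lifts (algebraMap M L) :=
    (Polynomial.mem_lifts _).2 ⟨∏ g : Γ, (Polynomial.X - Polynomial.C ⟨g.1 x, hM _ g.2 _ hx⟩), by
      simp [p, Polynomial.map_prod]⟩
  have hpΓ (g : Γ) : p.map (g.1 : L →+* L) = p := by
    simp only [p, Polynomial.map_prod, Polynomial.map_sub, Polynomial.map_X, Polynomial.map_C]
    exact Fintype.prod_equiv (Equiv.mulLeft g) _ _ fun h => by simp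
  have hpF : p ∈ Polynomial.lifts (algebraMap F L) := by
    rw [Polynomial.lifts_iff_coeff_lifts] at hpM ⊢
    intro n
    obtain ⟨c, hc⟩ := hpM n
    refine ⟨⟨p.coeff n, hMF ⟨hc ▸ c.2, ?_⟩⟩, rfl⟩
    refine (IntermediateField.mem_fixedField_iff _ _).2 fun g hg => ?_
    have := congr_arg (Polynomial.coeff · n) (hpΓ ⟨g, hg⟩)
    simpa using this
  obtain ⟨q, hq, -, hq'⟩ := Polynomial.lifts_and_natDegree_eq_and_monic hpF hp
  refine ⟨q, hq', ?_⟩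
  rw [← Polynomial.eval_map, hq, Polynomial.eval_prod]
  exact Finset.prod_eq_zero (Finset.mem_univ 1) (by simp)

theorem isAlgebraic_fixedField : Algebra.IsAlgebraic (IntermediateField.fixedField Γ) L :=
  ⟨fun _ => (isIntegral_of_stable Γ (M := ⊤) (fun _ _ _ _ => trivial) inf_le_right
    trivial).isAlgebraic⟩

variable [CharZero k]

theorem sup_inf_fixedField_le {M F : IntermediateField k L} (hM : ∀ g ∈ Γ, ∀ x ∈ M, g x ∈ M)
    (hF : F ≤ IntermediateField.fixedField Γ)
    (hMF : M ⊓ IntermediateField.fixedField Γ ≤ F) :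
    (F ⊔ M) ⊓ IntermediateField.fixedField Γ ≤ F := by
  have := Fintype.ofFinite Γ
  have : CharZero L := charZero_of_injective_algebraMap (algebraMap k L).injective
  have key (x : L) (hx : x ∈ F ⊔ M) : ∑ g : Γ, g.1 x ∈ F := by
    rw [← M.adjoin_self, ← IntermediateField.restrictScalars_adjoin_eq_sup,
      IntermediateField.mem_restrictScalars,
      ← IntermediateField.mem_toSubalgebra, IntermediateField.adjoin_toSubalgebra_of_isAlgebraic
        (fun y hy => (isIntegral_of_stable Γ hM hMF hy).isAlgebraic),
      ← Subalgebra.mem_toSubmodule, Algebra.adjoin_eq_span] at hx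
    have hcl : (Submonoid.closure (M : Set L) : Set L) = M :=
      congr_arg SetLike.coe (Submonoid.closure_eq M.toSubfield.toSubmonoid)
    rw [hcl] at hx
    induction hx using Submodule.span_induction with
    | mem x hx =>
      refine hMF ⟨sum_mem fun g _ => hM _ g.2 _ hx, ?_⟩
      refine (IntermediateField.mem_fixedField_iff _ _).2 fun g hg => ?_
      rw [map_sum]
      exact Fintype.sum_equiv (Equiv.mulLeft ⟨g, hg⟩) _ _ fun h => by simp
    | zero => simp
    | add x y _ _ hx hy => simpa [Finset.sum_add_distrib] using add_mem hx hy
    | smul a x _ hx =>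
      have (g : Γ) : g.1 (a • x) = a • g.1 x := by
        rw [Algebra.smul_def, Algebra.smul_def, map_mul]
        congr 1
        exact (IntermediateField.mem_fixedField_iff _ _).1 (hF a.2) _ g.2
      simp_rw [this, ← Finset.smul_sum, Algebra.smul_def]
      exact mul_mem a.2 hx
  rintro x ⟨hx, hx'⟩
  have h := key x hx
  have h2 (g : Γ) : g.1 x = x := (IntermediateField.mem_fixedField_iff _ _).1 hx' _ g.2
  simp_rw [h2, Finset.sum_const, nsmul_eq_mul] at h
  have := F.div_mem h (natCast_mem F (Finset.univ (α := Γ)).card)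
  rwa [mul_div_cancel_left₀] at this
  simp [Finset.card_univ]

theorem eq_fixedField_of_pow_mem {M F : IntermediateField k L} (hM : ∀ g ∈ Γ, ∀ x ∈ M, g x ∈ M)
    (hF : F ≤ IntermediateField.fixedField Γ)
    (hMF : M ⊓ IntermediateField.fixedField Γ ≤ F) {y : L}
    (hy : y ^ Nat.card (Γ ⊓ M.fixingSubgroup : Subgroup _) ∈ F ⊔ M)
    (htop : F ⊔ M ⊔ IntermediateField.adjoin k {y} = ⊤) :
    F = IntermediateField.fixedField Γ := by
  set Γ₀ := Γ ⊓ M.fixingSubgroup with hΓ₀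
  have : Finite Γ₀ := Finite.of_injective (Subgroup.inclusion inf_le_left)
    (Subgroup.inclusion_injective _)
  have hR : F ⊔ M ≤ IntermediateField.fixedField Γ₀ := by
    refine sup_le (hF.trans (IntermediateField.fixedField_antitone inf_le_left)) ?_
    exact (IntermediateField.le_iff_le _ _).2 inf_le_right
  let p : Polynomial ↥(F ⊔ M) := Polynomial.X ^ Nat.card Γ₀ - Polynomial.C ⟨_, hy⟩
  have hp : p.Monic := Polynomial.monic_X_pow_sub_C _ Nat.card_pos.ne'
  have hpy : Polynomial.aeval y p = 0 := by simp [p, IntermediateField.algebraMap_apply]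
  have hint : IsIntegral ↥(F ⊔ M) y := ⟨p, hp, hpy⟩
  have htop' : IntermediateField.adjoin ↥(F ⊔ M) {y} = ⊤ := by
    rw [← IntermediateField.restrictScalars_eq_top_iff (K := k),
      IntermediateField.restrictScalars_adjoin_eq_sup, htop]
  have : FiniteDimensional ↥(F ⊔ M) L := by
    have := IntermediateField.adjoin.finiteDimensional hint
    rw [htop'] at this
    exact IntermediateField.topEquiv.toLinearEquiv.finiteDimensional
  have hle : Module.finrank ↥(F ⊔ M) L ≤ Nat.card Γ₀ := by
    rw [← IntermediateField.finrank_top', ← htop', IntermediateField.adjoin.finrank hint]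
    exact (Polynomial.natDegree_le_of_dvd (minpoly.dvd _ _ hpy) hp.ne_zero).trans
      (Polynomial.natDegree_X_pow_sub_C).le
  have hcard : Module.finrank (IntermediateField.fixedField Γ₀) L = Nat.card Γ₀ := by
    have := Fintype.ofFinite Γ₀
    rw [Nat.card_eq_fintype_card]
    exact FixedPoints.finrank_eq_card Γ₀ L
  have heq := IntermediateField.eq_of_le_of_finrank_le' hR (hle.trans_eq hcard.symm)
  refine le_antisymm hF (le_trans (le_inf ?_ le_rfl) (sup_inf_fixedField_le Γ hM hF hMF))
  exact heq ▸ IntermediateField.fixedField_antitone inf_le_left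

theorem le_span_fixedField {M : IntermediateField k L} (hM : ∀ g ∈ Γ, ∀ x ∈ M, g x ∈ M)
    (W : Submodule M L) (hW : ∀ g ∈ Γ, ∀ w ∈ W, g w ∈ W)
    (hker : ∀ g ∈ Γ, (∀ x ∈ M, g x = x) → ∀ w ∈ W, g w = w) :
    W ≤ Submodule.span M {w | w ∈ W ∧ w ∈ IntermediateField.fixedField Γ} := by
  classical
  have := Fintype.ofFinite Γ
  have : CharZero L := charZero_of_injective_algebraMap (algebraMap k L).injective
  intro w hw
  by_contra hw'
  obtain ⟨φ, hφ, hφS⟩ := Submodule.exists_le_ker_of_notMem hw'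
  let χ (g : Γ) : M →* L := (g.1 : L →* L).comp (M.val : M →* L)
  have hsum (c : M) : ∑ g : Γ, g.1 c * φ (g.1 w) = 0 := by
    have h1 : ∑ g : Γ, g.1 (c • w) ∈ (φ : L →ₗ[M] M).ker := by
      refine hφS (Submodule.subset_span ⟨sum_mem fun g _ => hW _ g.2 _ (W.smul_mem _ hw), ?_⟩)
      refine (IntermediateField.mem_fixedField_iff _ _).2 fun g hg => ?_
      rw [map_sum]
      exact Fintype.sum_equiv (Equiv.mulLeft ⟨g, hg⟩) _ _ fun h => by simp
    have h2 (g : Γ) : g.1 (c • w) = (⟨g.1 c, hM _ g.2 _ c.2⟩ : M) • g.1 w := by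
      simp [Algebra.smul_def, IntermediateField.algebraMap_apply]
    rw [LinearMap.mem_ker, map_sum] at h1
    simpa [h2] using congr_arg (algebraMap M L) h1
  let l : (M →* L) →₀ L := ∑ g : Γ, Finsupp.single (χ g) (φ (g.1 w) : L)
  have hl : l = 0 := by
    refine linearIndependent_iff.1 (linearIndependent_monoidHom M L) l ?_
    ext c
    simpa [l, χ, mul_comm] using hsum c
  have h1 : l (χ 1) = Fintype.card {g : Γ // χ g = χ 1} * φ w := by
    simp only [l, Finsupp.finsetSum_apply, Finsupp.single_apply]
    rw [← Finset.sum_filter, Finset.sum_congr rfl (g := fun _ => (φ w : L)), Finset.sum_const,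
      nsmul_eq_mul, Fintype.card_subtype]
    intro g hg
    rw [hker g.1 g.2 (fun x hx => DFunLike.congr_fun (Finset.mem_filter.1 hg).2 ⟨x, hx⟩) w hw]
  have : Nonempty {g : Γ // χ g = χ 1} := ⟨⟨1, rfl⟩⟩
  rw [hl, Finsupp.zero_apply, eq_comm, mul_eq_zero, Nat.cast_eq_zero] at h1
  exact h1.elim Fintype.card_ne_zero fun h => hφ (by simpa using h)

theorem exists_fixed_generators {M : IntermediateField k L} (hM : ∀ g ∈ Γ, ∀ x ∈ M, g x ∈ M)
    {ι : Type*} {y : ι → L} (hy : LinearIndependent M y)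
    (hW : ∀ g ∈ Γ, ∀ i, g (y i) ∈ Submodule.span M (Set.range y))
    (hker : ∀ g ∈ Γ, (∀ x ∈ M, g x = x) → ∀ i, g (y i) = y i) :
    ∃ z : ι → L, (∀ i, z i ∈ IntermediateField.fixedField Γ) ∧
      Submodule.span M (Set.range z) = Submodule.span M (Set.range y) := by
  have hsmul (g : L ≃ₐ[k] L) (hg : g ∈ Γ) (a : M) (w : L) :
      g (a • w) = (⟨g a, hM _ hg _ a.2⟩ : M) • g w := by
    simp [Algebra.smul_def, IntermediateField.algebraMap_apply]
  have hle := le_span_fixedField Γ hM (Submodule.span M (Set.range y))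
    (fun g hg w hw => by
      induction hw using Submodule.span_induction with
      | mem x hx => obtain ⟨i, rfl⟩ := hx; exact hW g hg i
      | zero => simp
      | add x y _ _ hx hy => simpa using add_mem hx hy
      | smul a x _ hx => rw [hsmul g hg]; exact Submodule.smul_mem _ _ hx)
    (fun g hg hgM w hw => by
      induction hw using Submodule.span_induction with
      | mem x hx => obtain ⟨i, rfl⟩ := hx; exact hker g hg hgM i
      | zero => simp
      | add x y _ _ hx hy => simp [hx, hy]
      | smul a x _ hx => simp [Algebra.smul_def, IntermediateField.algebraMap_apply, hx, hgM a a.2])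
  obtain ⟨b, hbS, hspan, hb⟩ := exists_linearIndependent M
    {w | w ∈ Submodule.span M (Set.range y) ∧ w ∈ IntermediateField.fixedField Γ}
  have heq : Submodule.span M (Set.range (Subtype.val : b → L)) =
      Submodule.span M (Set.range y) := by
    rw [Subtype.range_coe, hspan]
    exact le_antisymm (Submodule.span_le.2 fun w hw => hw.1) hle
  let e := (((Module.Basis.span hb).map (LinearEquiv.ofEq _ _ heq)).indexEquiv
    (Module.Basis.span hy)).symm
  refine ⟨Subtype.val ∘ e, fun i => (hbS (e i).2).2, ?_⟩
  rw [e.surjective.range_comp, heq]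

theorem exists_fixedField_eq_sup_adjoin {ι κ : Type*} [Finite ι] {x : ι → L} {y : κ → L}
    (hxy : AlgebraicIndependent k (Sum.elim x y))
    (htop : IntermediateField.adjoin k (Set.range x) ⊔ IntermediateField.adjoin k (Set.range y) = ⊤)
    (hx : ∀ g ∈ Γ, ∀ i, g (x i) ∈ Submodule.span k (Set.range x))
    (hy : ∀ g ∈ Γ, ∀ i, g (y i) ∈ Submodule.span k (Set.range y))
    (hfaith : ∀ g ∈ Γ, (∀ i, g (y i) = y i) → g = 1) :
    ∃ z : ι → L, (∀ i, z i ∈ IntermediateField.fixedField Γ) ∧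
      AlgebraicIndependent (IntermediateField.adjoin k (Set.range y)) z ∧
      IntermediateField.adjoin k (Set.range y) ⊔ IntermediateField.adjoin k (Set.range z) = ⊤ ∧
      (IntermediateField.adjoin k (Set.range y) ⊓ IntermediateField.fixedField Γ) ⊔
        IntermediateField.adjoin k (Set.range z) = IntermediateField.fixedField Γ := by
  set M := IntermediateField.adjoin k (Set.range y) with hMdef
  have hM : ∀ g ∈ Γ, ∀ a ∈ M, g a ∈ M := fun g hg a ha =>
    apply_mem_adjoin g (by rintro _ ⟨i, rfl⟩; exact span_le_adjoin _ (hy g hg i)) ha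
  have hxM : AlgebraicIndependent M x :=
    IntermediateField.algebraicIndependent_adjoin_iff.2
      (AlgebraicIndependent.sumElim_iff.1 hxy).2
  obtain ⟨z, hz, hspan⟩ := exists_fixed_generators Γ hM hxM.linearIndependent
    (fun g hg i => Submodule.span_le_restrictScalars k M _ (hx g hg i))
    (fun g hg hgM i => by
      rw [hfaith g hg fun i => hgM _ (IntermediateField.subset_adjoin _ _ ⟨i, rfl⟩)]; rfl)
  have hspan_le : (Submodule.span M (Set.range z) : Set L) ⊆
      (M ⊔ IntermediateField.adjoin k (Set.range z) : IntermediateField k L) := by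
    rw [← IntermediateField.restrictScalars_adjoin_eq_sup]
    exact span_le_adjoin (k := M) (Set.range z)
  have hzM : M ⊔ IntermediateField.adjoin k (Set.range z) = ⊤ := by
    rw [eq_top_iff, ← htop, sup_le_iff]
    refine ⟨IntermediateField.adjoin_le_iff.2 fun w hw => hspan_le ?_, le_sup_left⟩
    rw [hspan]
    exact Submodule.subset_span hw
  have hzM' : IntermediateField.adjoin M (Set.range z) = ⊤ := by
    rw [← IntermediateField.restrictScalars_eq_top_iff (K := k),
      IntermediateField.restrictScalars_adjoin_eq_sup, hzM]
  have hzfix : IntermediateField.adjoin k (Set.range z) ≤ IntermediateField.fixedField Γ :=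
    IntermediateField.adjoin_le_iff.2 (by rintro _ ⟨i, rfl⟩; exact hz i)
  refine ⟨z, hz, algebraicIndependent_of_card_le hxM le_rfl ?_, hzM, ?_⟩
  · rw [hzM']
    exact ⟨fun a => isAlgebraic_algebraMap (⟨a, trivial⟩ : (⊤ : IntermediateField M L))⟩
  · refine le_antisymm (sup_le inf_le_right hzfix) (le_trans (le_inf ?_ le_rfl)
      (sup_inf_fixedField_le Γ hM (sup_le inf_le_right hzfix) le_sup_left))
    refine le_top.trans (hzM.symm.le.trans (sup_le le_sup_right ?_))
    exact le_sup_right.trans le_sup_left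

theorem exists_algebraicIndependent_fixedField_eq_adjoin {ι : Type*} [Finite ι]
    {x : ι → L} {y : Fin 2 → L} (hxy : AlgebraicIndependent k (Sum.elim x y))
    (htop : IntermediateField.adjoin k (Set.range x) ⊔ IntermediateField.adjoin k (Set.range y) = ⊤)
    (hx : ∀ g ∈ Γ, ∀ i, g (x i) ∈ Submodule.span k (Set.range x))
    (hy : ∀ g ∈ Γ, ∀ i, g (y i) ∈ Submodule.span k (Set.range y))
    (hfaith : ∀ g ∈ Γ, (∀ i, g (y i) = y i) → g = 1) :
    ∃ t : ι ⊕ Fin 2 → L, AlgebraicIndependent k t ∧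
      IntermediateField.adjoin k (Set.range t) = IntermediateField.fixedField Γ := by
  obtain ⟨z, hz, -, hzM, -⟩ := exists_fixedField_eq_sup_adjoin Γ hxy htop hx hy hfaith
  have hy1 : y 1 ≠ 0 := hxy.ne_zero (Sum.inr 1)
  set s := y 0 / y 1 with hs
  set K := IntermediateField.adjoin k {s} with hK
  have hsK : s ∈ K := IntermediateField.mem_adjoin_simple_self k s
  have hlin (g : L ≃ₐ[k] L) (hg : g ∈ Γ) (i : Fin 2) : ∃ β ∈ K, g (y i) = β * y 1 := by
    obtain ⟨c, hc⟩ := (Submodule.mem_span_range_iff_exists_fun k).1 (hy g hg i)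
    refine ⟨c 0 • s + c 1 • 1, add_mem (K.smul_mem hsK) (K.smul_mem K.one_mem), ?_⟩
    rw [← hc, Fin.sum_univ_two, Algebra.smul_def, Algebra.smul_def, Algebra.smul_def,
      Algebra.smul_def, hs]
    field_simp
  have hKstable : ∀ g ∈ Γ, ∀ a ∈ K, g a ∈ K := fun g hg a ha => by
    refine apply_mem_adjoin g ?_ ha
    rintro _ rfl
    obtain ⟨β, hβ, h0⟩ := hlin g hg 0
    obtain ⟨γ, hγ, h1⟩ := hlin g hg 1
    rw [hs, map_div₀, h0, h1, mul_div_mul_right _ _ hy1]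
    exact K.div_mem hβ hγ
  set N := Nat.card (Γ ⊓ K.fixingSubgroup : Subgroup _) with hN
  have hker : ∀ g ∈ Γ, (∀ a ∈ K, g a = a) → g (y 1 ^ N) = y 1 ^ N := fun g hg hgK => by
    obtain ⟨β, hβ, h⟩ := hlin g hg 1
    have hpow (n : ℕ) : (g ^ n) (y 1) = β ^ n * y 1 := by
      induction n with
      | zero => simp
      | succ n ih => rw [pow_succ', AlgEquiv.mul_apply, ih, map_mul, map_pow, hgK β hβ, h]; ring
    have hgN : g ^ N = 1 := by
      have hmem : g ∈ Γ ⊓ K.fixingSubgroup :=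
        ⟨hg, (IntermediateField.mem_fixingSubgroup_iff _ _).2 hgK⟩
      exact congr_arg Subtype.val (pow_card_eq_one' (x := (⟨g, hmem⟩ : ↥(Γ ⊓ K.fixingSubgroup))))
    have hβN : β ^ N = 1 := by
      have := hpow N
      rw [hgN, AlgEquiv.one_apply] at this
      exact (mul_eq_right₀ hy1).1 this.symm
    rw [map_pow, h, mul_pow, hβN, one_mul]
  obtain ⟨f, hf, hfspan⟩ := exists_fixed_generators Γ hKstable (y := fun _ : Unit => y 1 ^ N)
    (LinearIndependent.of_subsingleton () (pow_ne_zero _ hy1))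
    (fun g hg _ => by
      obtain ⟨β, hβ, h⟩ := hlin g hg 1
      have : g (y 1 ^ N) = (⟨β, hβ⟩ ^ N : K) • y 1 ^ N := by
        rw [map_pow, h, mul_pow, Algebra.smul_def, map_pow]; rfl
      rw [this]
      exact Submodule.smul_mem _ _ (Submodule.subset_span ⟨(), rfl⟩))
    (fun g hg hgK _ => hker g hg hgK)
  have htop' : IntermediateField.adjoin k (Set.range z) ⊔ K ⊔ IntermediateField.adjoin k {y 1} =
      ⊤ := by
    have h1 : y 1 ∈ IntermediateField.adjoin k (Set.range z) ⊔ K ⊔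
        IntermediateField.adjoin k {y 1} :=
      (le_sup_right : IntermediateField.adjoin k {y 1} ≤ _)
        (IntermediateField.mem_adjoin_simple_self k (y 1))
    have h0 : s ∈ IntermediateField.adjoin k (Set.range z) ⊔ K ⊔
        IntermediateField.adjoin k {y 1} := (le_sup_right.trans le_sup_left : K ≤ _) hsK
    rw [eq_top_iff, ← hzM]
    refine sup_le (IntermediateField.adjoin_le_iff.2 ?_) (le_sup_left.trans le_sup_left)
    rintro _ ⟨i, rfl⟩
    fin_cases i
    · have := mul_mem h0 h1
      rwa [hs, div_mul_cancel₀ _ hy1] at this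
    · exact h1
  have hstrans : Transcendental k s := by
    have hind : AlgebraicIndependent k (Sum.elim z ![s, y 1]) := by
      refine algebraicIndependent_of_card_le hxy le_rfl ?_
      have : IntermediateField.adjoin k (Set.range (Sum.elim z ![s, y 1])) = ⊤ := by
        rw [Set.Sum.elim_range, IntermediateField.adjoin_union, ← htop', Matrix.range_cons,
          Matrix.range_cons, Matrix.range_empty, Set.union_empty, IntermediateField.adjoin_union,
          sup_assoc]
      rw [this]
      exact ⟨fun a => isAlgebraic_algebraMap (⟨a, trivial⟩ : (⊤ : IntermediateField k L))⟩
    exact hind.transcendental (Sum.inr 0)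
  obtain ⟨u, hu⟩ := exists_eq_adjoin_of_le_adjoin_simple hstrans
    (E := K ⊓ IntermediateField.fixedField Γ) inf_le_left
  have hrange : IntermediateField.adjoin k (Set.range (Sum.elim z ![u, f ()])) =
      IntermediateField.adjoin k (Set.range z) ⊔ (K ⊓ IntermediateField.fixedField Γ ⊔
        IntermediateField.adjoin k {f ()}) := by
    rw [Set.Sum.elim_range, IntermediateField.adjoin_union, hu, Matrix.range_cons,
      Matrix.range_cons, Matrix.range_empty, Set.union_empty, IntermediateField.adjoin_union]
  have heq : IntermediateField.adjoin k (Set.range (Sum.elim z ![u, f ()])) =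
      IntermediateField.fixedField Γ := by
    refine eq_fixedField_of_pow_mem Γ hKstable (y := y 1) ?_ ?_ ?_ ?_
    · rw [hrange]
      refine sup_le (IntermediateField.adjoin_le_iff.2 ?_) (sup_le inf_le_right
        (IntermediateField.adjoin_le_iff.2 ?_))
      · rintro _ ⟨i, rfl⟩; exact hz i
      · rintro _ rfl; exact hf ()
    · rw [hrange]
      exact le_sup_left.trans le_sup_right
    · have hmem : y 1 ^ N ∈ Submodule.span K (Set.range f) :=
        hfspan ▸ Submodule.subset_span ⟨(), rfl⟩
      rw [Set.range_unique, Submodule.mem_span_singleton] at hmem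
      obtain ⟨c, hc⟩ := hmem
      rw [← hN, ← hc, Algebra.smul_def]
      refine mul_mem ((le_sup_right : K ≤ _) c.2) ((le_sup_left : _ ≤ _ ⊔ K) ?_)
      exact IntermediateField.subset_adjoin _ _ ⟨Sum.inr 1, rfl⟩
    · rw [eq_top_iff, ← htop', hrange]
      exact sup_le_sup_right (sup_le_sup_right le_sup_left _) _
  refine ⟨_, algebraicIndependent_of_card_le hxy le_rfl ?_, heq⟩
  rw [heq]
  exact isAlgebraic_fixedField Γ

end

section
variable {k L : Type*} [Field k] [Field L] [Algebra k L]

theorem nonempty_fractionRing_equiv_of_sup_adjoin_eq {ι K : Type*} [Field K] [Algebra k K]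
    (E : IntermediateField k K) (j : K →ₐ[k] L) {M F : IntermediateField k L} {z : ι → L}
    (hE : E.map j ≤ M) (hz : AlgebraicIndependent M z)
    (hF : E.map j ⊔ IntermediateField.adjoin k (Set.range z) = F) :
    Nonempty (FractionRing (MvPolynomial ι E) ≃ₐ[k] F) := by
  have hz' : AlgebraicIndependent (E.map j) z :=
    AlgebraicIndependent.of_ringHom_of_comp_eq (IntermediateField.inclusion hE) (RingHom.id L) hz
      (IntermediateField.inclusion hE).injective rfl
  have h : (IntermediateField.adjoin (E.map j) (Set.range z)).restrictScalars k = F := by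
    rw [IntermediateField.restrictScalars_adjoin_eq_sup, hF]
  exact ⟨((IsFractionRing.algEquivOfAlgEquiv
    (MvPolynomial.mapAlgEquiv ι (IntermediateField.equivMap E j))).trans
      (hz'.aevalEquivField.restrictScalars k)).trans (IntermediateField.equivOfEq h)⟩

theorem exists_monoidHom_fractionRing {ι G : Type*} [Fintype ι] [DecidableEq ι] [Group G]
    (B : G →* Matrix ι ι k) :
    ∃ b : G →* (FractionRing (MvPolynomial ι k) ≃ₐ[k] FractionRing (MvPolynomial ι k)),
      ∀ g i, b g (algebraMap (MvPolynomial ι k) _ (X i)) =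
        algebraMap (MvPolynomial ι k) _ (∑ j, B g⁻¹ i j • X j) := by
  let f : G →* (MvPolynomial ι k →ₐ[k] MvPolynomial ι k) :=
    { toFun := fun g => aeval fun i => ∑ j, B g⁻¹ i j • X j
      map_one' := by ext i; simp [Matrix.one_apply, ite_smul]
      map_mul' := fun g h => by
        refine MvPolynomial.algHom_ext fun i => ?_
        simp only [mul_inv_rev, map_mul, Matrix.mul_apply, Finset.sum_smul, AlgHom.mul_apply,
          aeval_X, map_sum, map_smul, Finset.smul_sum, mul_smul]
        exact Finset.sum_comm }
  refine ⟨(IsFractionRing.fieldEquivOfAlgEquivHom k (FractionRing (MvPolynomial ι k))).comp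
    ((AlgEquiv.algHomUnitsEquiv k (MvPolynomial ι k)).toMonoidHom.comp f.toHomUnits),
    fun g i => ?_⟩
  simp [f]

theorem map_fixedField_range {G K : Type*} [Field K] [Algebra k K] [Group G]
    (a : G →* (K ≃ₐ[k] K)) (b : G →* (L ≃ₐ[k] L)) (j : K →ₐ[k] L)
    (hj : ∀ g x, j (a g x) = b g (j x)) :
    (IntermediateField.fixedField a.range).map j =
      j.fieldRange ⊓ IntermediateField.fixedField b.range := by
  ext w
  constructor
  · rintro ⟨x, hx, rfl⟩
    refine ⟨⟨x, rfl⟩, (IntermediateField.mem_fixedField_iff _ _).2 ?_⟩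
    rintro _ ⟨g, rfl⟩
    exact (hj g x).symm.trans
      (congr_arg j ((IntermediateField.mem_fixedField_iff _ _).1 hx _ ⟨g, rfl⟩))
  · rintro ⟨⟨x, rfl⟩, hx⟩
    refine ⟨x, (IntermediateField.mem_fixedField_iff _ _).2 ?_, rfl⟩
    rintro _ ⟨g, rfl⟩
    exact j.injective ((hj g x).trans ((IntermediateField.mem_fixedField_iff _ _).1 hx _ ⟨g, rfl⟩))

end

section
variable {k : Type*} [Field k]

theorem eq_one_of_sum_smul_eq {ι V : Type*} [Fintype ι] [DecidableEq ι] [AddCommGroup V]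
    [Module k V] {v : ι → V} (hv : LinearIndependent k v) {A : Matrix ι ι k}
    (h : ∀ i, ∑ j, A i j • v j = v i) : A = 1 := by
  ext i j
  refine Fintype.linearIndependent_iff.1 hv (fun j => A i j - (1 : Matrix ι ι k) i j) ?_ j |>
    sub_eq_zero.1
  simp [sub_smul, Finset.sum_sub_distrib, h, Matrix.one_apply, ite_smul]

theorem exists_algHom_fractionRing {ι L : Type*} [Field L] [Algebra k L] {x : ι → L}
    (hx : AlgebraicIndependent k x) :
    ∃ j : FractionRing (MvPolynomial ι k) →ₐ[k] L,
      (∀ i, j (algebraMap (MvPolynomial ι k) _ (X i)) = x i) ∧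
      j.fieldRange = IntermediateField.adjoin k (Set.range x) := by
  refine ⟨(IntermediateField.adjoin k (Set.range x)).val.comp hx.aevalEquivField.toAlgHom,
    fun i => by simp, ?_⟩
  ext w
  constructor
  · rintro ⟨v, rfl⟩
    exact (hx.aevalEquivField v).2
  · exact fun hw => ⟨hx.aevalEquivField.symm ⟨w, hw⟩, by simp⟩

theorem algHom_algebraMap_sum_smul {ι R K L : Type*} [Fintype ι] [CommRing R] [Field K] [Field L]
    [Algebra k R] [Algebra k K] [Algebra k L] [Algebra R K] [IsScalarTower k R K]
    (f : K →ₐ[k] L) (c : ι → k) (p : ι → R) :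
    f (algebraMap R K (∑ i, c i • p i)) = ∑ i, c i • f (algebraMap R K (p i)) := by
  have h := map_sum (f.comp (IsScalarTower.toAlgHom k R K)) (fun i => c i • p i) Finset.univ
  simp only [map_smul] at h
  exact h

theorem algHom_fractionRing_ext {ι L : Type*} [Field L] [Algebra k L]
    {f g : FractionRing (MvPolynomial ι k) →ₐ[k] L}
    (h : ∀ i, f (algebraMap (MvPolynomial ι k) _ (X i)) =
      g (algebraMap (MvPolynomial ι k) _ (X i))) : f = g :=
  IsLocalization.algHom_ext (nonZeroDivisors (MvPolynomial ι k))
    (MvPolynomial.algHom_ext h)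

theorem adjoin_range_algebraMap_X {ι : Type*} :
    IntermediateField.adjoin k (Set.range fun i : ι =>
      algebraMap (MvPolynomial ι k) (FractionRing (MvPolynomial ι k)) (X i)) = ⊤ := by
  refine IsFractionRing.algHom_fieldRange_eq_of_comp_eq_of_range_eq
    (f := AlgHom.id k (FractionRing (MvPolynomial ι k)))
    (g := (IsScalarTower.toAlgHom k (MvPolynomial ι k) (FractionRing (MvPolynomial ι k))))
    rfl ?_ |>.symm.trans ?_
  · rw [← Algebra.map_top, ← MvPolynomial.adjoin_range_X, AlgHom.map_adjoin, ← Set.range_comp]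
    rfl
  · exact eq_top_iff.2 fun x _ => ⟨x, rfl⟩

theorem algebraicIndependent_algebraMap_X {ι : Type*} :
    AlgebraicIndependent k fun i : ι =>
      algebraMap (MvPolynomial ι k) (FractionRing (MvPolynomial ι k)) (X i) :=
  (MvPolynomial.algebraicIndependent_X ι k).map'
    (f := IsScalarTower.toAlgHom k (MvPolynomial ι k) (FractionRing (MvPolynomial ι k)))
    (IsFractionRing.injective _ _)

end

/-- Let `k` be a field of characteristic zero and
let `H` be a finite subgroup of `GL₂(k)`.  Then for any faithful linear representation
`V = k^m` of `H` over `k` (given by an injective homomorphism `ρ : H →* GLₘ(k)` with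
induced action `a` on the rational function field `k(V)`), the invariant field `k(V)^H`
is stably pure over `k`. -/
theorem invariant_field_of_finite_subgroup_of_GL2_stably_pure
    (k : Type) [Field k] [CharZero k]
    (H : Subgroup (Matrix.GeneralLinearGroup (Fin 2) k)) [Finite H]
    (m : ℕ)
    (ρ : H →* Matrix.GeneralLinearGroup (Fin m) k)
    (hρ : Function.Injective ρ)
    (a : H →* (FractionRing (MvPolynomial (Fin m) k) ≃ₐ[k]
      FractionRing (MvPolynomial (Fin m) k)))
    (ha : ∀ (g : H) (i : Fin m),
      a g (algebraMap (MvPolynomial (Fin m) k) (FractionRing (MvPolynomial (Fin m) k)) (X i)) =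
        algebraMap (MvPolynomial (Fin m) k) (FractionRing (MvPolynomial (Fin m) k))
          (∑ j, ((ρ g⁻¹ : Matrix (Fin m) (Fin m) k) i j) • X j)) :
    ∃ r t : ℕ, Nonempty
      (FractionRing (MvPolynomial (Fin r) (IntermediateField.fixedField a.range)) ≃ₐ[k]
       FractionRing (MvPolynomial (Fin t) k)) := by
  let ρ' : H →* Matrix (Fin m) (Fin m) k := (Units.coeHom _).comp ρ
  let τ : H →* Matrix (Fin 2) (Fin 2) k := (Units.coeHom _).comp H.subtype
  have hρ' : Function.Injective ρ' := Units.val_injective.comp hρ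
  have hτ : Function.Injective τ := Units.val_injective.comp H.subtype_injective
  let B : H →* Matrix (Fin m ⊕ Fin 2) (Fin m ⊕ Fin 2) k :=
    { toFun := fun g => Matrix.fromBlocks (ρ' g) 0 0 (τ g)
      map_one' := by simp
      map_mul' := fun g h => by simp [Matrix.fromBlocks_multiply] }
  obtain ⟨b, hb⟩ := exists_monoidHom_fractionRing B
  let v : Fin m ⊕ Fin 2 → FractionRing (MvPolynomial (Fin m ⊕ Fin 2) k) := fun i =>
    algebraMap (MvPolynomial (Fin m ⊕ Fin 2) k) _ (X i)
  let x : Fin m → FractionRing (MvPolynomial (Fin m ⊕ Fin 2) k) := v ∘ Sum.inl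
  let y : Fin 2 → FractionRing (MvPolynomial (Fin m ⊕ Fin 2) k) := v ∘ Sum.inr
  have hv : AlgebraicIndependent k v := algebraicIndependent_algebraMap_X
  have hx : AlgebraicIndependent k x := hv.comp _ Sum.inl_injective
  have hy : AlgebraicIndependent k y := hv.comp _ Sum.inr_injective
  have hvtop : IntermediateField.adjoin k (Set.range x) ⊔
      IntermediateField.adjoin k (Set.range y) = ⊤ := by
    rw [← IntermediateField.adjoin_union, ← Set.Sum.elim_range, Sum.elim_comp_inl_inr]
    exact adjoin_range_algebraMap_X
  have hbx (g : H) (i : Fin m) : b g (x i) = ∑ j, ρ' g⁻¹ i j • x j := by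
    refine (hb g (Sum.inl i)).trans ?_
    refine (algHom_algebraMap_sum_smul
      (AlgHom.id k (FractionRing (MvPolynomial (Fin m ⊕ Fin 2) k)))
      (B g⁻¹ (Sum.inl i)) (X : _ → MvPolynomial (Fin m ⊕ Fin 2) k)).trans ?_
    simp [B, x, v]
  have hby (g : H) (i : Fin 2) : b g (y i) = ∑ j, τ g⁻¹ i j • y j := by
    refine (hb g (Sum.inr i)).trans ?_
    refine (algHom_algebraMap_sum_smul
      (AlgHom.id k (FractionRing (MvPolynomial (Fin m ⊕ Fin 2) k)))
      (B g⁻¹ (Sum.inr i)) (X : _ → MvPolynomial (Fin m ⊕ Fin 2) k)).trans ?_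
    simp [B, y, v]
  have hxspan : ∀ g ∈ b.range, ∀ i, g (x i) ∈ Submodule.span k (Set.range x) := by
    rintro _ ⟨g, rfl⟩ i
    rw [hbx]
    exact sum_mem fun j _ => Submodule.smul_mem _ _ (Submodule.subset_span ⟨j, rfl⟩)
  have hyspan : ∀ g ∈ b.range, ∀ i, g (y i) ∈ Submodule.span k (Set.range y) := by
    rintro _ ⟨g, rfl⟩ i
    rw [hby]
    exact sum_mem fun j _ => Submodule.smul_mem _ _ (Submodule.subset_span ⟨j, rfl⟩)
  have hxfaith : ∀ g ∈ b.range, (∀ i, g (x i) = x i) → g = 1 := by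
    rintro _ ⟨g, rfl⟩ h
    have h1 := eq_one_of_sum_smul_eq hx.linearIndependent fun i => (hbx g i).symm.trans (h i)
    rw [inv_eq_one.1 ((map_eq_one_iff ρ' hρ').1 h1), map_one]
  have hyfaith : ∀ g ∈ b.range, (∀ i, g (y i) = y i) → g = 1 := by
    rintro _ ⟨g, rfl⟩ h
    have h1 := eq_one_of_sum_smul_eq hy.linearIndependent fun i => (hby g i).symm.trans (h i)
    rw [inv_eq_one.1 ((map_eq_one_iff τ hτ).1 h1), map_one]
  have : Finite b.range := Set.finite_range b
  obtain ⟨t, ht, htfix⟩ := exists_algebraicIndependent_fixedField_eq_adjoin b.range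
    (by rwa [Sum.elim_comp_inl_inr]) hvtop hxspan hyspan hyfaith
  have hswap : v ∘ Sum.swap = Sum.elim y x := by ext (i | i) <;> rfl
  obtain ⟨z, -, hz, -, hzfix⟩ := exists_fixedField_eq_sup_adjoin b.range (x := y) (y := x)
    (hswap ▸ hv.comp Sum.swap Sum.swap_leftInverse.injective)
    (sup_comm _ _ |>.trans hvtop) hyspan hxspan hxfaith
  obtain ⟨j, hjX, hjrange⟩ := exists_algHom_fractionRing hx
  have hj (g : H) (w) : j (a g w) = b g (j w) := by
    refine DFunLike.congr_fun (algHom_fractionRing_ext (f := j.comp (a g).toAlgHom)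
      (g := (b g).toAlgHom.comp j) fun i => ?_) w
    change j (a g _) = b g (j _)
    rw [ha, hjX, hbx]
    refine (algHom_algebraMap_sum_smul j _ _).trans ?_
    simp only [hjX]
    rfl
  have hmap := map_fixedField_range a b j hj
  rw [hjrange] at hmap
  obtain ⟨e⟩ := nonempty_fractionRing_equiv_of_sup_adjoin_eq (IntermediateField.fixedField a.range)
    j (hmap.trans_le inf_le_left) hz (hmap.symm ▸ hzfix)
  have ht' := ht.comp finSumFinEquiv.symm finSumFinEquiv.symm.injective
  refine ⟨2, m + 2, ⟨e.trans ((IntermediateField.equivOfEq ?_).trans ht'.aevalEquivField.symm)⟩⟩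
  rw [finSumFinEquiv.symm.surjective.range_comp, htfix]
end

section
/- (Maeda's theorem for the natural representation of A_5.) Let k be a field of characteristic zero and let the alternating group A_5 act on the rational function field k(x_1,…,x_5) by permuting the five variables (the natural 5-dimensional permutation representation). Then the fixed field k(x_1,…,x_5)^{A_5} is purely transcendental over k. -/
open Polynomial in
theorem mem_range_algebraMap_of_forall_perm {F K : Type*} [Field F] [Field K] [Algebra F K]
    {n : ℕ} {p : F[X]} (hp : p.natDegree = n) {y : Fin n → K} (hy : Function.Injective y)
    (hroot : ∀ i, aeval (y i) p = 0) (hp0 : p ≠ 0) (htop : Algebra.adjoin F (Set.range y) = ⊤)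
    {m : K} (hm : ∀ (σ : K ≃ₐ[F] K) (π : Equiv.Perm (Fin n)),
      (∀ i, σ (y i) = y (π i)) → σ m = m) :
    m ∈ Set.range (algebraMap F K) := by
  have hpK : p.map (algebraMap F K) ≠ 0 := Polynomial.map_ne_zero hp0
  have hroots : (p.map (algebraMap F K)).roots = (Finset.univ : Finset (Fin n)).val.map y := by
    refine (Multiset.eq_of_le_of_card_le ?_ ?_).symm
    · refine (Multiset.le_iff_subset (Finset.univ.nodup.map hy)).2 fun z hz ↦ ?_
      obtain ⟨i, -, rfl⟩ := Multiset.mem_map.1 hz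
      rw [mem_roots hpK, IsRoot, eval_map_algebraMap, hroot]
    · refine (card_roots' _).trans ?_
      simp [hp]
  have hsplits : (p.map (algebraMap F K)).Splits := by
    rw [splits_iff_card_roots, hroots]
    simp [hp]
  have hset : p.rootSet K = Set.range y := by
    ext z
    rw [rootSet, aroots, hroots]
    simp
  have hsep : p.Separable := by
    refine (nodup_aroots_iff_of_splits hp0 hsplits).1 ?_
    rw [aroots, hroots]
    exact Finset.univ.nodup.map hy
  have : p.IsSplittingField F K := ⟨hsplits, by rw [hset, htop]⟩
  have : IsGalois F K := IsGalois.of_separable_splitting_field hsep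
  have : FiniteDimensional F K := IsSplittingField.finiteDimensional K p
  refine (IsGalois.mem_range_algebraMap_iff_fixed m).2 fun σ ↦ ?_
  have hσ (i : Fin n) : ∃ j, y j = σ (y i) := by
    have : σ (y i) ∈ p.rootSet K := by
      rw [mem_rootSet_of_ne hp0, aeval_algHom_apply]
      simp [hroot]
    rwa [hset] at this
  choose π hπ using hσ
  have hinj : Function.Injective π := fun i j hij ↦ hy (σ.injective (by rw [← hπ, ← hπ, hij]))
  exact hm σ (Equiv.ofBijective π (Finite.injective_iff_bijective.1 hinj)) fun i ↦ (hπ i).symm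

theorem adjoin_range_algebraMap_X_s11 (σ k : Type*) [Field k] :
    IntermediateField.adjoin k (Set.range (algebraMap (MvPolynomial σ k)
      (FractionRing (MvPolynomial σ k)) ∘ MvPolynomial.X)) = ⊤ := by
  set S := Set.range (algebraMap (MvPolynomial σ k) (FractionRing (MvPolynomial σ k)) ∘
    MvPolynomial.X)
  have hmem (p : MvPolynomial σ k) : algebraMap (MvPolynomial σ k)
      (FractionRing (MvPolynomial σ k)) p ∈ IntermediateField.adjoin k S := by
    induction p using MvPolynomial.induction_on with
    | C c =>
      rw [← MvPolynomial.algebraMap_eq, ← IsScalarTower.algebraMap_apply]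
      exact IntermediateField.algebraMap_mem _ c
    | add p q hp hq => simpa using add_mem hp hq
    | mul_X p i hp =>
      rw [map_mul]
      exact mul_mem hp (IntermediateField.subset_adjoin k S ⟨i, rfl⟩)
  refine eq_top_iff.2 fun z _ ↦ ?_
  obtain ⟨p, q, -, rfl⟩ := IsFractionRing.div_surjective (A := MvPolynomial σ k) z
  exact div_mem (hmem p) (hmem q)

/-- A binary quintic form `∑ (5 choose i) aᵢ X ^ (5 - i) Y ^ i`, given by its coefficients. -/
@[ext]
structure BinaryQuintic (R : Type*) where
  a0 : R
  a1 : R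
  a2 : R
  a3 : R
  a4 : R
  a5 : R

namespace BinaryQuintic

section Covariants

variable {R : Type*} [CommRing R] (f : BinaryQuintic R)

/-- The value of the form at `(x, 1)`. -/
def eval (x : R) : R :=
  f.a0 * x ^ 5 + 5 * f.a1 * x ^ 4 + 10 * f.a2 * x ^ 3 + 10 * f.a3 * x ^ 2 + 5 * f.a4 * x + f.a5

/-- The form `f (p X + q Y, r X + s Y)`. -/
def subst (p q r s : R) : BinaryQuintic R where
  a0 := f.a0 * p ^ 5 + 5 * f.a1 * p ^ 4 * r + 10 * f.a2 * p ^ 3 * r ^ 2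
    + 10 * f.a3 * p ^ 2 * r ^ 3 + 5 * f.a4 * p * r ^ 4 + f.a5 * r ^ 5
  a1 := f.a0 * p ^ 4 * q + f.a1 * (4 * p ^ 3 * q * r + p ^ 4 * s)
    + f.a2 * (6 * p ^ 2 * q * r ^ 2 + 4 * p ^ 3 * r * s)
    + f.a3 * (4 * p * q * r ^ 3 + 6 * p ^ 2 * r ^ 2 * s)
    + f.a4 * (q * r ^ 4 + 4 * p * r ^ 3 * s) + f.a5 * r ^ 4 * s
  a2 := f.a0 * p ^ 3 * q ^ 2 + f.a1 * (3 * p ^ 2 * q ^ 2 * r + 2 * p ^ 3 * q * s)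
    + f.a2 * (3 * p * q ^ 2 * r ^ 2 + 6 * p ^ 2 * q * r * s + p ^ 3 * s ^ 2)
    + f.a3 * (q ^ 2 * r ^ 3 + 6 * p * q * r ^ 2 * s + 3 * p ^ 2 * r * s ^ 2)
    + f.a4 * (2 * q * r ^ 3 * s + 3 * p * r ^ 2 * s ^ 2) + f.a5 * r ^ 3 * s ^ 2
  a3 := f.a0 * p ^ 2 * q ^ 3 + f.a1 * (2 * p * q ^ 3 * r + 3 * p ^ 2 * q ^ 2 * s)
    + f.a2 * (q ^ 3 * r ^ 2 + 6 * p * q ^ 2 * r * s + 3 * p ^ 2 * q * s ^ 2)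
    + f.a3 * (3 * q ^ 2 * r ^ 2 * s + 6 * p * q * r * s ^ 2 + p ^ 2 * s ^ 3)
    + f.a4 * (3 * q * r ^ 2 * s ^ 2 + 2 * p * r * s ^ 3) + f.a5 * r ^ 2 * s ^ 3
  a4 := f.a0 * p * q ^ 4 + f.a1 * (q ^ 4 * r + 4 * p * q ^ 3 * s)
    + f.a2 * (4 * q ^ 3 * r * s + 6 * p * q ^ 2 * s ^ 2)
    + f.a3 * (6 * q ^ 2 * r * s ^ 2 + 4 * p * q * s ^ 3)
    + f.a4 * (4 * q * r * s ^ 3 + p * s ^ 4) + f.a5 * r * s ^ 4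
  a5 := f.a0 * q ^ 5 + 5 * f.a1 * q ^ 4 * s + 10 * f.a2 * q ^ 3 * s ^ 2
    + 10 * f.a3 * q ^ 2 * s ^ 3 + 5 * f.a4 * q * s ^ 4 + f.a5 * s ^ 5

/-- The first coefficient of the quadratic covariant `(f, f)₄` of degree two. -/
def quad0 : R := 2 * (f.a0 * f.a4 - 4 * f.a1 * f.a3 + 3 * f.a2 ^ 2)

/-- The middle coefficient of the quadratic covariant of degree two. -/
def quad1 : R := f.a0 * f.a5 - 3 * f.a1 * f.a4 + 2 * f.a2 * f.a3

/-- The last coefficient of the quadratic covariant of degree two. -/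
def quad2 : R := 2 * (f.a1 * f.a5 - 4 * f.a2 * f.a4 + 3 * f.a3 ^ 2)

/-- The first coefficient of the cubic covariant of degree three. -/
def cub0 : R := f.a0 * f.quad2 - 2 * f.a1 * f.quad1 + f.a2 * f.quad0

/-- The second coefficient of the cubic covariant of degree three. -/
def cub1 : R := f.a1 * f.quad2 - 2 * f.a2 * f.quad1 + f.a3 * f.quad0

/-- The third coefficient of the cubic covariant of degree three. -/
def cub2 : R := f.a2 * f.quad2 - 2 * f.a3 * f.quad1 + f.a4 * f.quad0

/-- The last coefficient of the cubic covariant of degree three. -/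
def cub3 : R := f.a3 * f.quad2 - 2 * f.a4 * f.quad1 + f.a5 * f.quad0

/-- The first coefficient of the Hessian of the cubic covariant, a quadratic covariant of degree
six. -/
def hess0 : R := 2 * (f.cub0 * f.cub2 - f.cub1 ^ 2)

/-- The middle coefficient of the Hessian of the cubic covariant. -/
def hess1 : R := f.cub0 * f.cub3 - f.cub1 * f.cub2

/-- The last coefficient of the Hessian of the cubic covariant. -/
def hess2 : R := 2 * (f.cub1 * f.cub3 - f.cub2 ^ 2)

/-- The first coefficient of the linear covariant of degree five. -/
def linA0 : R := f.cub0 * f.quad2 - 2 * f.cub1 * f.quad1 + f.cub2 * f.quad0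

/-- The last coefficient of the linear covariant of degree five. -/
def linA1 : R := f.cub1 * f.quad2 - 2 * f.cub2 * f.quad1 + f.cub3 * f.quad0

/-- The first coefficient of the linear covariant of degree seven. -/
def linB0 : R := f.quad0 * f.linA1 - f.quad1 * f.linA0

/-- The last coefficient of the linear covariant of degree seven. -/
def linB1 : R := f.quad1 * f.linA1 - f.quad2 * f.linA0

/-- The first coefficient of the linear covariant of degree eleven. -/
def linC0 : R := f.hess0 * f.linA1 - f.hess1 * f.linA0

/-- The last coefficient of the linear covariant of degree eleven. -/
def linC1 : R := f.hess1 * f.linA1 - f.hess2 * f.linA0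

/-- The invariant of degree four. -/
def inv4 : R := f.quad0 * f.quad2 - f.quad1 ^ 2

/-- The invariant of degree eight. -/
def inv8 : R := f.quad0 * f.hess2 - 2 * f.quad1 * f.hess1 + f.quad2 * f.hess0

/-- The invariant of degree twelve. -/
def inv12 : R := f.hess0 * f.hess2 - f.hess1 ^ 2

/-- The invariant of degree eighteen. -/
def inv18 : R := f.linB0 * f.linC1 - f.linB1 * f.linC0

section Subst

variable (p q r s : R)

theorem quad0_subst : (f.subst p q r s).quad0 =
    (p * s - q * r) ^ 4 * (f.quad0 * p ^ 2 + 2 * f.quad1 * p * r + f.quad2 * r ^ 2) := by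
  simp only [quad0, quad1, quad2, subst]; ring

theorem quad1_subst : (f.subst p q r s).quad1 =
    (p * s - q * r) ^ 4 *
      (f.quad0 * p * q + f.quad1 * (p * s + q * r) + f.quad2 * r * s) := by
  simp only [quad0, quad1, quad2, subst]; ring

theorem quad2_subst : (f.subst p q r s).quad2 =
    (p * s - q * r) ^ 4 * (f.quad0 * q ^ 2 + 2 * f.quad1 * q * s + f.quad2 * s ^ 2) := by
  simp only [quad0, quad1, quad2, subst]; ring

theorem cub0_subst : (f.subst p q r s).cub0 = (p * s - q * r) ^ 6 *
    (f.cub0 * p ^ 3 + 3 * f.cub1 * p ^ 2 * r + 3 * f.cub2 * p * r ^ 2 + f.cub3 * r ^ 3) := by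
  simp only [cub0, quad0_subst, quad1_subst, quad2_subst]
  simp only [cub1, cub2, cub3, subst]; ring

theorem cub1_subst : (f.subst p q r s).cub1 = (p * s - q * r) ^ 6 *
    (f.cub0 * p ^ 2 * q + f.cub1 * (2 * p * q * r + p ^ 2 * s)
      + f.cub2 * (q * r ^ 2 + 2 * p * r * s) + f.cub3 * r ^ 2 * s) := by
  simp only [cub1, quad0_subst, quad1_subst, quad2_subst]
  simp only [cub0, cub2, cub3, subst]; ring

theorem cub2_subst : (f.subst p q r s).cub2 = (p * s - q * r) ^ 6 *
    (f.cub0 * p * q ^ 2 + f.cub1 * (q ^ 2 * r + 2 * p * q * s)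
      + f.cub2 * (2 * q * r * s + p * s ^ 2) + f.cub3 * r * s ^ 2) := by
  simp only [cub2, quad0_subst, quad1_subst, quad2_subst]
  simp only [cub0, cub1, cub3, subst]; ring

theorem cub3_subst : (f.subst p q r s).cub3 = (p * s - q * r) ^ 6 *
    (f.cub0 * q ^ 3 + 3 * f.cub1 * q ^ 2 * s + 3 * f.cub2 * q * s ^ 2 + f.cub3 * s ^ 3) := by
  simp only [cub3, quad0_subst, quad1_subst, quad2_subst]
  simp only [cub0, cub1, cub2, subst]; ring

theorem hess0_subst : (f.subst p q r s).hess0 =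
    (p * s - q * r) ^ 14 * (f.hess0 * p ^ 2 + 2 * f.hess1 * p * r + f.hess2 * r ^ 2) := by
  simp only [hess0, hess1, hess2, cub0_subst, cub1_subst, cub2_subst]; ring

theorem hess1_subst : (f.subst p q r s).hess1 =
    (p * s - q * r) ^ 14 *
      (f.hess0 * p * q + f.hess1 * (p * s + q * r) + f.hess2 * r * s) := by
  simp only [hess0, hess1, hess2, cub0_subst, cub1_subst, cub2_subst, cub3_subst]; ring

theorem hess2_subst : (f.subst p q r s).hess2 =
    (p * s - q * r) ^ 14 * (f.hess0 * q ^ 2 + 2 * f.hess1 * q * s + f.hess2 * s ^ 2) := by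
  simp only [hess0, hess1, hess2, cub1_subst, cub2_subst, cub3_subst]; ring

theorem linA0_subst : (f.subst p q r s).linA0 =
    (p * s - q * r) ^ 12 * (f.linA0 * p + f.linA1 * r) := by
  simp only [linA0, linA1, cub0_subst, cub1_subst, cub2_subst, quad0_subst,
    quad1_subst, quad2_subst]
  ring

theorem linA1_subst : (f.subst p q r s).linA1 =
    (p * s - q * r) ^ 12 * (f.linA0 * q + f.linA1 * s) := by
  simp only [linA0, linA1, cub1_subst, cub2_subst, cub3_subst, quad0_subst,
    quad1_subst, quad2_subst]
  ring

theorem linB0_subst : (f.subst p q r s).linB0 =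
    (p * s - q * r) ^ 17 * (f.linB0 * p + f.linB1 * r) := by
  simp only [linB0, linB1, linA0_subst, linA1_subst, quad0_subst, quad1_subst]; ring

theorem linB1_subst : (f.subst p q r s).linB1 =
    (p * s - q * r) ^ 17 * (f.linB0 * q + f.linB1 * s) := by
  simp only [linB0, linB1, linA0_subst, linA1_subst, quad1_subst, quad2_subst]; ring

theorem linC0_subst : (f.subst p q r s).linC0 =
    (p * s - q * r) ^ 27 * (f.linC0 * p + f.linC1 * r) := by
  simp only [linC0, linC1, linA0_subst, linA1_subst, hess0_subst, hess1_subst]; ring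

theorem linC1_subst : (f.subst p q r s).linC1 =
    (p * s - q * r) ^ 27 * (f.linC0 * q + f.linC1 * s) := by
  simp only [linC0, linC1, linA0_subst, linA1_subst, hess1_subst, hess2_subst]; ring

theorem inv4_subst : (f.subst p q r s).inv4 = (p * s - q * r) ^ 10 * f.inv4 := by
  simp only [inv4, quad0_subst, quad1_subst, quad2_subst]; ring

theorem inv8_subst : (f.subst p q r s).inv8 = (p * s - q * r) ^ 20 * f.inv8 := by
  simp only [inv8, quad0_subst, quad1_subst, quad2_subst, hess0_subst, hess1_subst, hess2_subst]
  ring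

theorem inv12_subst : (f.subst p q r s).inv12 = (p * s - q * r) ^ 30 * f.inv12 := by
  simp only [inv12, hess0_subst, hess1_subst, hess2_subst]; ring

theorem inv18_subst : (f.subst p q r s).inv18 = (p * s - q * r) ^ 45 * f.inv18 := by
  simp only [inv18, linB0_subst, linB1_subst, linC0_subst, linC1_subst]; ring

end Subst

end Covariants

section Relations

variable {R : Type*} [CommRing R] (f : BinaryQuintic R)

/-- The numerator of the resolvent: `inv18 ^ 5` times the value at a point of the form, written
in terms of the values `A` and `B` of the two linear covariants at that point. -/
def typical (A B : R) : R :=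
  (24 * f.inv4 ^ 5 * f.inv8 ^ 2 - 243 * f.inv4 ^ 3 * f.inv8 ^ 3 + 32 * f.inv4 ^ 6 * f.inv12
    - 276 * f.inv4 ^ 4 * f.inv8 * f.inv12 + 1377 * f.inv4 ^ 2 * f.inv8 ^ 2 * f.inv12
    + 324 * f.inv4 ^ 3 * f.inv12 ^ 2 - 2376 * f.inv4 * f.inv8 * f.inv12 ^ 2
    + 1296 * f.inv12 ^ 3) * A ^ 5
  + 5 * f.inv18 * (-16 * f.inv4 ^ 4 + 54 * f.inv4 ^ 2 * f.inv8 - 72 * f.inv4 * f.inv12)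
    * A ^ 4 * B
  + 10 * (-24 * f.inv4 ^ 4 * f.inv8 ^ 2 - 81 * f.inv4 ^ 2 * f.inv8 ^ 3
    - 32 * f.inv4 ^ 5 * f.inv12 + 228 * f.inv4 ^ 3 * f.inv8 * f.inv12
    + 189 * f.inv4 * f.inv8 ^ 2 * f.inv12 - 252 * f.inv4 ^ 2 * f.inv12 ^ 2
    - 108 * f.inv8 * f.inv12 ^ 2) * A ^ 3 * B ^ 2
  + 10 * f.inv18 * (16 * f.inv4 ^ 3 - 30 * f.inv4 * f.inv8 + 36 * f.inv12) * A ^ 2 * B ^ 3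
  + 5 * (24 * f.inv4 ^ 3 * f.inv8 ^ 2 + 21 * f.inv4 * f.inv8 ^ 3 + 32 * f.inv4 ^ 4 * f.inv12
    - 180 * f.inv4 ^ 2 * f.inv8 * f.inv12 - 27 * f.inv8 ^ 2 * f.inv12
    + 180 * f.inv4 * f.inv12 ^ 2) * A * B ^ 4
  + f.inv18 * (-16 * f.inv4 ^ 2 + 6 * f.inv8) * B ^ 5

/-- The square of the invariant of degree eighteen. -/
def sq18 : R :=
  -9 * f.inv4 * f.inv8 ^ 4 - 24 * f.inv4 ^ 2 * f.inv8 ^ 2 * f.inv12 + 12 * f.inv8 ^ 3 * f.inv12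
    - 16 * f.inv4 ^ 3 * f.inv12 ^ 2 + 144 * f.inv4 * f.inv8 * f.inv12 ^ 2 - 144 * f.inv12 ^ 3

theorem typical_depressed (a b c : R) :
    (⟨0, 1, 0, a, b, c⟩ : BinaryQuintic R).typical (linA0 ⟨0, 1, 0, a, b, c⟩)
      (linB0 ⟨0, 1, 0, a, b, c⟩) = 0 := by
  simp only [typical, inv4, inv8, inv12, inv18, linB0, linB1, linC0, linC1, linA0, linA1, hess0,
    hess1, hess2, cub0, cub1, cub2, cub3, quad0, quad1, quad2]
  ring

theorem inv18_sq_depressed (a b c : R) : 4 * (inv18 ⟨0, 1, 0, a, b, c⟩) ^ 2 =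
    sq18 (⟨0, 1, 0, a, b, c⟩ : BinaryQuintic R) := by
  simp only [sq18, inv4, inv8, inv12, inv18, linB0, linB1, linC0, linC1, linA0, linA1, hess0,
    hess1, hess2, cub0, cub1, cub2, cub3, quad0, quad1, quad2]
  ring

theorem typical_subst (p q r s A B : R) :
    (f.subst p q r s).typical ((p * s - q * r) ^ 12 * A) ((p * s - q * r) ^ 17 * B) =
      (p * s - q * r) ^ 150 * f.typical A B := by
  simp only [typical, inv4_subst, inv8_subst, inv12_subst, inv18_subst]
  generalize p * s - q * r = d
  ring

theorem sq18_subst (p q r s : R) :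
    (f.subst p q r s).sq18 = (p * s - q * r) ^ 90 * f.sq18 := by
  simp only [sq18, inv4_subst, inv8_subst, inv12_subst]
  generalize p * s - q * r = d
  ring

end Relations

section Roots

theorem exists_subst_eq_depressed {K : Type*} [Field K] [NeZero (2 : K)] (f : BinaryQuintic K)
    {x : K} (hx : f.eval x = 0)
    (hx' : f.a0 * x ^ 4 + 4 * f.a1 * x ^ 3 + 6 * f.a2 * x ^ 2 + 4 * f.a3 * x + f.a4 ≠ 0) :
    ∃ q s a b c : K, x * s - q * 1 ≠ 0 ∧ f.subst x q 1 s = ⟨0, 1, 0, a, b, c⟩ := by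
  set D := f.a0 * x ^ 4 + 4 * f.a1 * x ^ 3 + 6 * f.a2 * x ^ 2 + 4 * f.a3 * x + f.a4 with hD
  set E := f.a0 * x ^ 3 + 3 * f.a1 * x ^ 2 + 3 * f.a2 * x + f.a3 with hE
  have h2 : (2 : K) ≠ 0 := two_ne_zero
  obtain ⟨l, hl⟩ : ∃ l : K, l * D = 1 := ⟨D⁻¹, inv_mul_cancel₀ hx'⟩
  obtain ⟨m, hm⟩ : ∃ m : K, E + 2 * m * D = 0 := ⟨-E / (2 * D), by field_simp; ring⟩
  rw [eval] at hx
  refine ⟨x * (m * l) + l, m * l, _, _, _, ?_, BinaryQuintic.ext ?_ ?_ ?_ rfl rfl rfl⟩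
  · have hl0 : l ≠ 0 := left_ne_zero_of_mul_eq_one hl
    rwa [show x * (m * l) - (x * (m * l) + l) * 1 = -l by ring, neg_ne_zero]
  · simp only [subst]
    linear_combination hx
  · simp only [subst]
    linear_combination hl + m * l * hx - l * hD
  · simp only [subst]
    linear_combination l ^ 2 * hm + m ^ 2 * l ^ 2 * hx - l ^ 2 * hE - 2 * m * l ^ 2 * hD

theorem typical_eval {K : Type*} [Field K] [NeZero (2 : K)] (f : BinaryQuintic K)
    {x : K} (hx : f.eval x = 0)
    (hx' : f.a0 * x ^ 4 + 4 * f.a1 * x ^ 3 + 6 * f.a2 * x ^ 2 + 4 * f.a3 * x + f.a4 ≠ 0) :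
    f.typical (f.linA0 * x + f.linA1) (f.linB0 * x + f.linB1) = 0 := by
  obtain ⟨q, s, a, b, c, hd, h⟩ := f.exists_subst_eq_depressed hx hx'
  have key := typical_depressed a b c
  rw [← h, linA0_subst, linB0_subst, typical_subst] at key
  simpa using (mul_eq_zero.1 key).resolve_left (pow_ne_zero _ hd)

theorem inv18_sq {K : Type*} [Field K] [NeZero (2 : K)] (f : BinaryQuintic K)
    {x : K} (hx : f.eval x = 0)
    (hx' : f.a0 * x ^ 4 + 4 * f.a1 * x ^ 3 + 6 * f.a2 * x ^ 2 + 4 * f.a3 * x + f.a4 ≠ 0) :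
    4 * f.inv18 ^ 2 = f.sq18 := by
  obtain ⟨q, s, a, b, c, hd, h⟩ := f.exists_subst_eq_depressed hx hx'
  have key := inv18_sq_depressed a b c
  rw [← h, inv18_subst, sq18_subst] at key
  refine mul_left_cancel₀ (pow_ne_zero 90 hd) ?_
  linear_combination key

section OfRoots

variable {R : Type*} [CommRing R]

/-- Ten times the monic quintic with the given roots. -/
noncomputable def ofRoots (x : Fin 5 → R) : BinaryQuintic R where
  a0 := 10
  a1 := 2 * (∏ i, (Polynomial.X - Polynomial.C (x i))).coeff 4
  a2 := (∏ i, (Polynomial.X - Polynomial.C (x i))).coeff 3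
  a3 := (∏ i, (Polynomial.X - Polynomial.C (x i))).coeff 2
  a4 := 2 * (∏ i, (Polynomial.X - Polynomial.C (x i))).coeff 1
  a5 := 10 * (∏ i, (Polynomial.X - Polynomial.C (x i))).coeff 0

theorem ofRoots_comp_perm (x : Fin 5 → R) (σ : Equiv.Perm (Fin 5)) :
    ofRoots (x ∘ σ) = ofRoots x := by
  simp only [ofRoots, Function.comp_apply]
  rw [Equiv.prod_comp σ fun i ↦ Polynomial.X - Polynomial.C (x i)]

theorem ofRoots_eq (x : Fin 5 → R) : ofRoots x = {
    a0 := 10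
    a1 := -2 * (x 0 + x 1 + x 2 + x 3 + x 4)
    a2 := x 0 * x 1 + x 0 * x 2 + x 0 * x 3 + x 0 * x 4 + x 1 * x 2 + x 1 * x 3 + x 1 * x 4
      + x 2 * x 3 + x 2 * x 4 + x 3 * x 4
    a3 := -(x 0 * x 1 * x 2 + x 0 * x 1 * x 3 + x 0 * x 1 * x 4 + x 0 * x 2 * x 3
      + x 0 * x 2 * x 4 + x 0 * x 3 * x 4 + x 1 * x 2 * x 3 + x 1 * x 2 * x 4
      + x 1 * x 3 * x 4 + x 2 * x 3 * x 4)
    a4 := 2 * (x 0 * x 1 * x 2 * x 3 + x 0 * x 1 * x 2 * x 4 + x 0 * x 1 * x 3 * x 4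
      + x 0 * x 2 * x 3 * x 4 + x 1 * x 2 * x 3 * x 4)
    a5 := -10 * (x 0 * x 1 * x 2 * x 3 * x 4) } := by
  have key : ∏ i, (Polynomial.X - Polynomial.C (x i)) = Polynomial.X ^ 5
      + Polynomial.C (-(x 0 + x 1 + x 2 + x 3 + x 4)) * Polynomial.X ^ 4
      + Polynomial.C (x 0 * x 1 + x 0 * x 2 + x 0 * x 3 + x 0 * x 4 + x 1 * x 2 + x 1 * x 3
        + x 1 * x 4 + x 2 * x 3 + x 2 * x 4 + x 3 * x 4) * Polynomial.X ^ 3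
      + Polynomial.C (-(x 0 * x 1 * x 2 + x 0 * x 1 * x 3 + x 0 * x 1 * x 4 + x 0 * x 2 * x 3
        + x 0 * x 2 * x 4 + x 0 * x 3 * x 4 + x 1 * x 2 * x 3 + x 1 * x 2 * x 4
        + x 1 * x 3 * x 4 + x 2 * x 3 * x 4)) * Polynomial.X ^ 2
      + Polynomial.C (x 0 * x 1 * x 2 * x 3 + x 0 * x 1 * x 2 * x 4 + x 0 * x 1 * x 3 * x 4
        + x 0 * x 2 * x 3 * x 4 + x 1 * x 2 * x 3 * x 4) * Polynomial.X
      + Polynomial.C (-(x 0 * x 1 * x 2 * x 3 * x 4)) := by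
    rw [Fin.prod_univ_five]
    simp only [map_neg, map_add, map_mul]
    ring
  rw [ofRoots, key]
  simp only [Polynomial.coeff_add, Polynomial.coeff_C_mul, Polynomial.coeff_X_pow,
    Polynomial.coeff_X, Polynomial.coeff_C]
  ext <;> norm_num
  all_goals ring

theorem eval_ofRoots (x : Fin 5 → R) (t : R) :
    (ofRoots x).eval t = 10 * ∏ i, (t - x i) := by
  simp only [eval, ofRoots_eq, Fin.prod_univ_five]
  ring

theorem polar_ofRoots_zero (x : Fin 5 → R) :
    (ofRoots x).a0 * x 0 ^ 4 + 4 * (ofRoots x).a1 * x 0 ^ 3 + 6 * (ofRoots x).a2 * x 0 ^ 2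
      + 4 * (ofRoots x).a3 * x 0 + (ofRoots x).a4 =
    2 * ((x 0 - x 1) * (x 0 - x 2) * (x 0 - x 3) * (x 0 - x 4)) := by
  simp only [ofRoots_eq]
  ring

theorem ofRoots_sub (x : Fin 5 → R) (t : R) :
    ofRoots (fun i ↦ x i - t) = (ofRoots x).subst 1 t 0 1 := by
  ext <;> simp only [ofRoots_eq, subst] <;> ring

theorem inv4_sq_sub_of_a5_eq_zero (b c d e : R) :
    inv4 ⟨10, -2 * b, c, -d, 2 * e, 0⟩ ^ 2 - 16 * inv8 ⟨10, -2 * b, c, -d, 2 * e, 0⟩ =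
      32000 * (e ^ 2 * (256 * e ^ 3 - 192 * b * d * e ^ 2 - 128 * c ^ 2 * e ^ 2
        + 144 * c * d ^ 2 * e - 27 * d ^ 4 + 144 * b ^ 2 * c * e ^ 2 - 6 * b ^ 2 * d ^ 2 * e
        - 80 * b * c ^ 2 * d * e + 18 * b * c * d ^ 3 + 16 * c ^ 4 * e - 4 * c ^ 3 * d ^ 2
        - 27 * b ^ 4 * e ^ 2 + 18 * b ^ 3 * c * d * e - 4 * b ^ 3 * d ^ 3 - 4 * b ^ 2 * c ^ 3 * e
        + b ^ 2 * c ^ 2 * d ^ 2)) := by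
  simp only [inv4, inv8, hess0, hess1, hess2, cub0, cub1, cub2, cub3, quad0, quad1, quad2]
  ring

/-- The product of the differences of the roots. -/
def rootDisc (x : Fin 5 → R) : R := (Matrix.vandermonde x).det

theorem rootDisc_comp_perm (x : Fin 5 → R) (σ : Equiv.Perm (Fin 5)) :
    rootDisc (x ∘ σ) = (Equiv.Perm.sign σ : ℤ) * rootDisc x := by
  rw [rootDisc, rootDisc, ← Matrix.det_permute]
  rfl

theorem rootDisc_eq (x : Fin 5 → R) : rootDisc x =
    (x 1 - x 0) * (x 2 - x 0) * (x 3 - x 0) * (x 4 - x 0) * ((x 2 - x 1) * (x 3 - x 1)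
      * (x 4 - x 1) * (x 3 - x 2) * (x 4 - x 2) * (x 4 - x 3)) := by
  rw [rootDisc, Matrix.det_vandermonde, Fin.prod_univ_five]
  simp only [show Finset.Ioi (0 : Fin 5) = {1, 2, 3, 4} by decide,
    show Finset.Ioi (1 : Fin 5) = {2, 3, 4} by decide,
    show Finset.Ioi (2 : Fin 5) = {3, 4} by decide,
    show Finset.Ioi (3 : Fin 5) = {4} by decide,
    show Finset.Ioi (4 : Fin 5) = ∅ by decide]
  simp
  ring

theorem inv4_sq_ofRoots (x : Fin 5 → R) :
    (ofRoots x).inv4 ^ 2 = 16 * (ofRoots x).inv8 + 32000 * rootDisc x ^ 2 := by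
  have key (b c d e : R) :
      (ofRoots ![0, b, c, d, e]).inv4 ^ 2 - 16 * (ofRoots ![0, b, c, d, e]).inv8 =
        32000 * (b * c * d * e * ((c - b) * (d - b) * (e - b) * (d - c) * (e - c)
          * (e - d))) ^ 2 := by
    have h : ofRoots ![0, b, c, d, e] = ⟨10, -2 * (b + c + d + e),
        b * c + b * d + b * e + c * d + c * e + d * e,
        -(b * c * d + b * c * e + b * d * e + c * d * e), 2 * (b * c * d * e), 0⟩ := by
      rw [ofRoots_eq]
      simp
    rw [h, inv4_sq_sub_of_a5_eq_zero]
    ring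
  have h := ofRoots_sub x (x 0)
  rw [show (fun i ↦ x i - x 0) = ![0, x 1 - x 0, x 2 - x 0, x 3 - x 0, x 4 - x 0] by
    funext i; fin_cases i <;> simp] at h
  specialize key (x 1 - x 0) (x 2 - x 0) (x 3 - x 0) (x 4 - x 0)
  rw [h, inv4_subst, inv8_subst] at key
  simp only [sub_sub_sub_cancel_right] at key
  rw [rootDisc_eq]
  generalize (x 1 - x 0) * (x 2 - x 0) * (x 3 - x 0) * (x 4 - x 0) * _ = D at key ⊢
  linear_combination key

end OfRoots

end Roots

section Resolvent

/-- The resolvent quintic of a form whose three invariants of lowest degree are `1`, `b`, `c`. -/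
noncomputable def resolvent {F : Type*} [Field F] (b c : F) : BinaryQuintic F where
  a0 := -16 + 6 * b
  a1 := 24 * b ^ 2 + 21 * b ^ 3 + 32 * c - 180 * b * c - 27 * b ^ 2 * c + 180 * c ^ 2
  a2 := (-9 * b ^ 4 - 24 * b ^ 2 * c + 12 * b ^ 3 * c - 16 * c ^ 2 + 144 * b * c ^ 2
    - 144 * c ^ 3) / 4 * (16 - 30 * b + 36 * c)
  a3 := (-9 * b ^ 4 - 24 * b ^ 2 * c + 12 * b ^ 3 * c - 16 * c ^ 2 + 144 * b * c ^ 2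
    - 144 * c ^ 3) / 4 * (-24 * b ^ 2 - 81 * b ^ 3 - 32 * c + 228 * b * c + 189 * b ^ 2 * c
    - 252 * c ^ 2 - 108 * b * c ^ 2)
  a4 := ((-9 * b ^ 4 - 24 * b ^ 2 * c + 12 * b ^ 3 * c - 16 * c ^ 2 + 144 * b * c ^ 2
    - 144 * c ^ 3) / 4) ^ 2 * (-16 + 54 * b - 72 * c)
  a5 := ((-9 * b ^ 4 - 24 * b ^ 2 * c + 12 * b ^ 3 * c - 16 * c ^ 2 + 144 * b * c ^ 2
    - 144 * c ^ 3) / 4) ^ 2 * (24 * b ^ 2 - 243 * b ^ 3 + 32 * c - 276 * b * c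
    + 1377 * b ^ 2 * c + 324 * c ^ 2 - 2376 * b * c ^ 2 + 1296 * c ^ 3)

theorem quintic_of_scaled {R : Type*} [CommRing R] {t0 t1 t2 t3 t4 t5 A B j z S : R}
    (hj : j ^ 2 = S) (hz : j * B = z * A)
    (h : t0 * A ^ 5 + 5 * j * t1 * A ^ 4 * B + 10 * t2 * A ^ 3 * B ^ 2
      + 10 * j * t3 * A ^ 2 * B ^ 3 + 5 * t4 * A * B ^ 4 + j * t5 * B ^ 5 = 0) :
    A ^ 5 * (t5 * z ^ 5 + 5 * t4 * z ^ 4 + 10 * (S * t3) * z ^ 3 + 10 * (S * t2) * z ^ 2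
      + 5 * (S ^ 2 * t1) * z + S ^ 2 * t0) = 0 := by
  calc
    _ = t5 * (z * A) ^ 5 + 5 * t4 * (z * A) ^ 4 * A + 10 * (S * t3) * (z * A) ^ 3 * A ^ 2
        + 10 * (S * t2) * (z * A) ^ 2 * A ^ 3 + 5 * (S ^ 2 * t1) * (z * A) * A ^ 4
        + S ^ 2 * t0 * A ^ 5 := by ring
    _ = 0 := by
      rw [← hz, ← hj]
      linear_combination j ^ 4 * h

theorem eval_resolvent {K : Type*} [Field K] [NeZero (2 : K)] (f : BinaryQuintic K)
    (h4 : f.inv4 ≠ 0) (h18 : 4 * f.inv18 ^ 2 = f.sq18) {A B : K} (hA : A ≠ 0)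
    (h : f.typical A B = 0) :
    (resolvent (f.inv8 / f.inv4 ^ 2) (f.inv12 / f.inv4 ^ 3)).eval
      (f.inv18 * B / (f.inv4 ^ 5 * A)) = 0 := by
  have h2 : (4 : K) ≠ 0 := by
    rw [show (4 : K) = 2 * 2 by norm_num]
    exact mul_ne_zero two_ne_zero two_ne_zero
  rw [typical] at h
  rw [sq18] at h18
  generalize f.inv4 = I at *
  generalize f.inv18 = J at *
  obtain ⟨b, hb⟩ : ∃ b, f.inv8 / I ^ 2 = b := ⟨_, rfl⟩
  obtain ⟨c, hc⟩ : ∃ c, f.inv12 / I ^ 3 = c := ⟨_, rfl⟩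
  obtain ⟨y, hy⟩ : ∃ y, J * B / (I ^ 5 * A) = y := ⟨_, rfl⟩
  rw [hb, hc, hy]
  rw [div_eq_iff (by positivity)] at hb hc hy
  rw [hb, hc] at h h18
  obtain ⟨s, hs⟩ : ∃ s, (-9 * b ^ 4 - 24 * b ^ 2 * c + 12 * b ^ 3 * c - 16 * c ^ 2
    + 144 * b * c ^ 2 - 144 * c ^ 3) / 4 = s := ⟨_, rfl⟩
  simp only [resolvent, eval, hs]
  rw [div_eq_iff h2] at hs
  have hJ : J ^ 2 = I ^ 9 * s := mul_left_cancel₀ h2 (by linear_combination h18 + I ^ 9 * hs)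
  refine (mul_eq_zero.1 (?_ : I ^ 27 * A ^ 5 * _ = 0)).resolve_left (by positivity)
  linear_combination quintic_of_scaled hJ (by linear_combination hy : J * B = y * I ^ 5 * A) h

end Resolvent

section Map

variable {R S : Type*} [CommRing R] [CommRing S] (φ : R →+* S) (f : BinaryQuintic R)

/-- The image of a form under a ring homomorphism. -/
def map : BinaryQuintic S := ⟨φ f.a0, φ f.a1, φ f.a2, φ f.a3, φ f.a4, φ f.a5⟩

theorem ofRoots_map (x : Fin 5 → R) : (ofRoots x).map φ = ofRoots (φ ∘ x) := by
  simp [ofRoots_eq, map, map_ofNat]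

theorem quad0_map : (f.map φ).quad0 = φ f.quad0 := by
  simp [quad0, map, map_ofNat]

theorem quad1_map : (f.map φ).quad1 = φ f.quad1 := by
  simp [quad1, map, map_ofNat]

theorem quad2_map : (f.map φ).quad2 = φ f.quad2 := by
  simp [quad2, map, map_ofNat]

theorem cub0_map : (f.map φ).cub0 = φ f.cub0 := by
  simp only [cub0, quad0_map, quad1_map, quad2_map]
  simp [map, map_ofNat]

theorem cub1_map : (f.map φ).cub1 = φ f.cub1 := by
  simp only [cub1, quad0_map, quad1_map, quad2_map]
  simp [map, map_ofNat]

theorem cub2_map : (f.map φ).cub2 = φ f.cub2 := by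
  simp only [cub2, quad0_map, quad1_map, quad2_map]
  simp [map, map_ofNat]

theorem cub3_map : (f.map φ).cub3 = φ f.cub3 := by
  simp only [cub3, quad0_map, quad1_map, quad2_map]
  simp [map, map_ofNat]

theorem hess0_map : (f.map φ).hess0 = φ f.hess0 := by
  simp [hess0, cub0_map, cub1_map, cub2_map, map_ofNat]

theorem hess1_map : (f.map φ).hess1 = φ f.hess1 := by
  simp [hess1, cub0_map, cub1_map, cub2_map, cub3_map]

theorem hess2_map : (f.map φ).hess2 = φ f.hess2 := by
  simp [hess2, cub1_map, cub2_map, cub3_map, map_ofNat]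

theorem linA0_map : (f.map φ).linA0 = φ f.linA0 := by
  simp [linA0, cub0_map, cub1_map, cub2_map, quad0_map, quad1_map, quad2_map, map_ofNat]

theorem linA1_map : (f.map φ).linA1 = φ f.linA1 := by
  simp [linA1, cub1_map, cub2_map, cub3_map, quad0_map, quad1_map, quad2_map, map_ofNat]

theorem linB0_map : (f.map φ).linB0 = φ f.linB0 := by
  simp [linB0, linA0_map, linA1_map, quad0_map, quad1_map]

theorem linB1_map : (f.map φ).linB1 = φ f.linB1 := by
  simp [linB1, linA0_map, linA1_map, quad1_map, quad2_map]

theorem linC0_map : (f.map φ).linC0 = φ f.linC0 := by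
  simp [linC0, linA0_map, linA1_map, hess0_map, hess1_map]

theorem linC1_map : (f.map φ).linC1 = φ f.linC1 := by
  simp [linC1, linA0_map, linA1_map, hess1_map, hess2_map]

theorem inv4_map : (f.map φ).inv4 = φ f.inv4 := by
  simp [inv4, quad0_map, quad1_map, quad2_map]

theorem inv8_map : (f.map φ).inv8 = φ f.inv8 := by
  simp [inv8, quad0_map, quad1_map, quad2_map, hess0_map, hess1_map, hess2_map, map_ofNat]

theorem inv12_map : (f.map φ).inv12 = φ f.inv12 := by
  simp [inv12, hess0_map, hess1_map, hess2_map]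

theorem inv18_map : (f.map φ).inv18 = φ f.inv18 := by
  simp [inv18, linB0_map, linB1_map, linC0_map, linC1_map]

theorem rootDisc_map (x : Fin 5 → R) : rootDisc (φ ∘ x) = φ (rootDisc x) := by
  simp [rootDisc_eq]

end Map

section Generic

/-- Five points are generic if they are distinct and if the covariants of the quintic with these
roots that enter into denominators do not vanish. -/
structure Generic {R : Type*} [CommRing R] (x : Fin 5 → R) : Prop where
  rootDisc_ne : rootDisc x ≠ 0
  inv4_ne : (ofRoots x).inv4 ≠ 0
  inv18_ne : (ofRoots x).inv18 ≠ 0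
  linA0_ne : (ofRoots x).linA0 ≠ 0
  linB0_ne : (ofRoots x).linB0 ≠ 0
  det_ne : (ofRoots x).linA0 * (ofRoots x).linB1 - (ofRoots x).linA1 * (ofRoots x).linB0 ≠ 0
  lead_ne : -16 * (ofRoots x).inv4 ^ 2 + 6 * (ofRoots x).inv8 ≠ 0

theorem generic_int : Generic (![0, 1, -1, 2, 5] : Fin 5 → ℤ) := by
  constructor
  · simp [rootDisc_eq]
  all_goals
    simp [ofRoots_eq, inv4, inv8, inv18, linB0, linB1, linC0, linC1, linA0, linA1, hess0, hess1,
      hess2, cub0, cub1, cub2, cub3, quad0, quad1, quad2]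

variable {R S : Type*} [CommRing R] [CommRing S]

theorem Generic.map {x : Fin 5 → R} (h : Generic x) {φ : R →+* S} (hφ : Function.Injective φ) :
    Generic (φ ∘ x) := by
  have hne {z : R} (hz : z ≠ 0) : φ z ≠ 0 := (map_ne_zero_iff φ hφ).2 hz
  constructor
  · simpa only [rootDisc_map] using hne h.rootDisc_ne
  all_goals rw [← ofRoots_map]
  · simpa only [inv4_map] using hne h.inv4_ne
  · simpa only [inv18_map] using hne h.inv18_ne
  · simpa only [linA0_map] using hne h.linA0_ne
  · simpa only [linB0_map] using hne h.linB0_ne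
  · simpa [linA0_map, linA1_map, linB0_map, linB1_map] using hne h.det_ne
  · simpa [inv4_map, inv8_map, map_ofNat] using hne h.lead_ne

theorem Generic.of_map {x : Fin 5 → R} (φ : R →+* S) (h : Generic (φ ∘ x)) : Generic x := by
  obtain ⟨h1, h2, h3, h4, h5, h6, h7⟩ := h
  rw [← ofRoots_map] at h2 h3 h4 h5 h6 h7
  simp only [inv4_map, inv8_map, inv18_map, linA0_map, linA1_map, linB0_map, linB1_map,
    rootDisc_map] at h1 h2 h3 h4 h5 h6 h7
  have hne {z : R} (hz : φ z ≠ 0) : z ≠ 0 := fun h ↦ hz (by rw [h, map_zero])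
  refine ⟨hne h1, hne h2, hne h3, hne h4, hne h5, hne ?_, hne ?_⟩
  · simpa using h6
  · simpa [map_ofNat] using h7

theorem generic_X (k : Type*) [CommRing k] [CharZero k] :
    Generic (MvPolynomial.X : Fin 5 → MvPolynomial (Fin 5) k) := by
  refine .of_map (MvPolynomial.eval ((Int.castRingHom k) ∘ ![0, 1, -1, 2, 5])) ?_
  rw [show MvPolynomial.eval ((Int.castRingHom k) ∘ ![0, 1, -1, 2, 5]) ∘ MvPolynomial.X =
    (Int.castRingHom k) ∘ ![0, 1, -1, 2, 5] by ext; simp]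
  exact generic_int.map Int.cast_injective

end Generic

section Generators

variable {K : Type*} [Field K]

/-- The generators of the field of functions of five points that are invariant under even
permutations. -/
noncomputable def generators (x : Fin 5 → K) : Fin 5 → K :=
  ![(ofRoots x).linA1 / (ofRoots x).linA0, (ofRoots x).linB1 / (ofRoots x).linB0,
    (ofRoots x).inv18 * (ofRoots x).linB0 / ((ofRoots x).inv4 ^ 5 * (ofRoots x).linA0),
    rootDisc x / (ofRoots x).inv4, (ofRoots x).inv12 / (ofRoots x).inv4 ^ 3]

theorem generators_map {L : Type*} [Field L] (φ : K →+* L) (x : Fin 5 → K) :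
    generators (φ ∘ x) = φ ∘ generators x := by
  ext i
  fin_cases i <;> simp [generators, ← ofRoots_map, linA0_map, linA1_map, linB0_map, linB1_map,
    inv4_map, inv12_map, inv18_map, rootDisc_map]

theorem generators_comp_perm (x : Fin 5 → K) {π : Equiv.Perm (Fin 5)}
    (hπ : Equiv.Perm.sign π = 1) : generators (x ∘ π) = generators x := by
  simp [generators, ofRoots_comp_perm, rootDisc_comp_perm, hπ]

/-- The roots of the resolvent. -/
noncomputable def resolventRoot (x : Fin 5 → K) (i : Fin 5) : K :=
  (ofRoots x).inv18 * ((ofRoots x).linB0 * x i + (ofRoots x).linB1) /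
    ((ofRoots x).inv4 ^ 5 * ((ofRoots x).linA0 * x i + (ofRoots x).linA1))

namespace Generic

variable {x : Fin 5 → K} (h : Generic x)
include h

theorem injective : Function.Injective x :=
  Matrix.det_vandermonde_ne_zero_iff.1 h.rootDisc_ne

theorem polar_ne [NeZero (2 : K)] (i : Fin 5) :
    (ofRoots x).a0 * x i ^ 4 + 4 * (ofRoots x).a1 * x i ^ 3 + 6 * (ofRoots x).a2 * x i ^ 2
      + 4 * (ofRoots x).a3 * x i + (ofRoots x).a4 ≠ 0 := by
  have key := polar_ofRoots_zero (x ∘ Equiv.swap 0 i)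
  rw [ofRoots_comp_perm] at key
  simp only [Function.comp_apply, Equiv.swap_apply_left] at key
  rw [key]
  have hne (j : Fin 5) (hj : j ≠ 0) : x i - x (Equiv.swap 0 i j) ≠ 0 :=
    sub_ne_zero.2 fun hij ↦ hj <| by
      simpa using congrArg (Equiv.swap 0 i) (h.injective hij).symm
  have := hne 1 (by decide)
  have := hne 2 (by decide)
  have := hne 3 (by decide)
  have := hne 4 (by decide)
  have := two_ne_zero (α := K)
  positivity

theorem typical_eq_zero [NeZero (2 : K)] (i : Fin 5) :
    (ofRoots x).typical ((ofRoots x).linA0 * x i + (ofRoots x).linA1)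
      ((ofRoots x).linB0 * x i + (ofRoots x).linB1) = 0 := by
  refine typical_eval _ ?_ (h.polar_ne i)
  rw [eval_ofRoots, Finset.prod_eq_zero (Finset.mem_univ i) (sub_self _), mul_zero]

theorem linA_ne [NeZero (2 : K)] (i : Fin 5) :
    (ofRoots x).linA0 * x i + (ofRoots x).linA1 ≠ 0 := by
  intro hA
  have key := h.typical_eq_zero i
  have hB : (ofRoots x).linB0 * x i + (ofRoots x).linB1 ≠ 0 := fun hB ↦
    h.det_ne (by linear_combination (ofRoots x).linA0 * hB - (ofRoots x).linB0 * hA)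
  have := h.inv18_ne
  have := h.lead_ne
  rw [hA, typical] at key
  refine (by positivity : (ofRoots x).inv18 * (-16 * (ofRoots x).inv4 ^ 2 + 6 * (ofRoots x).inv8) *
    ((ofRoots x).linB0 * x i + (ofRoots x).linB1) ^ 5 ≠ 0) ?_
  linear_combination key

theorem eval_resolventRoot [NeZero (2 : K)] (i : Fin 5) :
    (resolvent ((ofRoots x).inv8 / (ofRoots x).inv4 ^ 2)
      ((ofRoots x).inv12 / (ofRoots x).inv4 ^ 3)).eval (resolventRoot x i) = 0 := by
  refine eval_resolvent _ h.inv4_ne (inv18_sq _ ?_ (h.polar_ne i)) (h.linA_ne i)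
    (h.typical_eq_zero i)
  rw [eval_ofRoots, Finset.prod_eq_zero (Finset.mem_univ i) (sub_self _), mul_zero]

theorem resolvent_a0_ne : (resolvent ((ofRoots x).inv8 / (ofRoots x).inv4 ^ 2)
    ((ofRoots x).inv12 / (ofRoots x).inv4 ^ 3)).a0 ≠ 0 := by
  have := h.inv4_ne
  have := h.lead_ne
  rw [resolvent, show -16 + 6 * ((ofRoots x).inv8 / (ofRoots x).inv4 ^ 2) =
    (-16 * (ofRoots x).inv4 ^ 2 + 6 * (ofRoots x).inv8) / (ofRoots x).inv4 ^ 2 by field_simp]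
  positivity

theorem inv8_div [NeZero (2 : K)] : (ofRoots x).inv8 / (ofRoots x).inv4 ^ 2 =
    (1 - 32000 * generators x 3 ^ 2) / 16 := by
  have := h.inv4_ne
  have h16 : (16 : K) ≠ 0 := by
    rw [show (16 : K) = 2 ^ 4 by norm_num]
    exact pow_ne_zero _ two_ne_zero
  simp only [generators, Matrix.cons_val]
  field_simp
  linear_combination -inv4_sq_ofRoots x

theorem resolventRoot_ne [NeZero (2 : K)] (i : Fin 5) : resolventRoot x i ≠ generators x 2 := by
  have := h.inv4_ne
  have := h.inv18_ne
  have := h.linA0_ne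
  have := h.linA_ne i
  simp only [resolventRoot, generators, Matrix.cons_val, Ne]
  rw [div_eq_div_iff (by positivity) (by positivity)]
  intro H
  refine (by positivity : (ofRoots x).inv18 * (ofRoots x).inv4 ^ 5 ≠ 0)
    ((mul_eq_zero.1 ?_).resolve_right h.det_ne)
  linear_combination H

theorem eq_of_resolventRoot [NeZero (2 : K)] (i : Fin 5) :
    x i = (generators x 2 * generators x 1 - generators x 0 * resolventRoot x i) /
      (resolventRoot x i - generators x 2) := by
  rw [eq_div_iff (sub_ne_zero.2 (h.resolventRoot_ne i))]
  have := h.inv4_ne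
  have := h.inv18_ne
  have := h.linA0_ne
  have := h.linB0_ne
  have := h.linA_ne i
  simp only [resolventRoot, generators, Matrix.cons_val]
  obtain ⟨A, hA⟩ : ∃ A, (ofRoots x).linA0 * x i + (ofRoots x).linA1 = A := ⟨_, rfl⟩
  rw [hA] at this ⊢
  field_simp
  rw [← hA]
  ring

theorem resolventRoot_injective [NeZero (2 : K)] : Function.Injective (resolventRoot x) :=
  fun i j hij ↦ h.injective <| by
    rw [h.eq_of_resolventRoot i, h.eq_of_resolventRoot j, hij]

end Generic

end Generators

section ToPoly

variable {R S : Type*} [CommRing R] [CommRing S]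

/-- The polynomial `f (X, 1)`. -/
noncomputable def toPoly (f : BinaryQuintic R) : Polynomial R :=
  .C f.a0 * .X ^ 5 + .C (5 * f.a1) * .X ^ 4 + .C (10 * f.a2) * .X ^ 3 + .C (10 * f.a3) * .X ^ 2
    + .C (5 * f.a4) * .X + .C f.a5

theorem natDegree_toPoly {f : BinaryQuintic R} (h : f.a0 ≠ 0) : f.toPoly.natDegree = 5 := by
  rw [toPoly]
  compute_degree!

theorem aeval_toPoly [Algebra R S] (f : BinaryQuintic R) (y : S) :
    Polynomial.aeval y f.toPoly = (f.map (algebraMap R S)).eval y := by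
  simp [toPoly, eval, map, map_ofNat]

theorem resolvent_map {F K : Type*} [Field F] [Field K] (φ : F →+* K) (b c : F) :
    (resolvent b c).map φ = resolvent (φ b) (φ c) := by
  simp [resolvent, map, map_ofNat]

end ToPoly

namespace Generic

open IntermediateField

variable {k K : Type*} [Field k] [Field K] [Algebra k K] [NeZero (2 : K)] {x : Fin 5 → K}
  (h : Generic x)
include h

theorem exists_polynomial : ∃ p : Polynomial (adjoin k (Set.range (generators x))),
    p.natDegree = 5 ∧ ∀ i, Polynomial.aeval (resolventRoot x i) p = 0 := by
  have hg (i : Fin 5) : generators x i ∈ adjoin k (Set.range (generators x)) :=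
    subset_adjoin _ _ ⟨i, rfl⟩
  have hb : (ofRoots x).inv8 / (ofRoots x).inv4 ^ 2 ∈ adjoin k (Set.range (generators x)) := by
    rw [h.inv8_div]
    exact div_mem (sub_mem (one_mem _) (mul_mem (ofNat_mem _ _) (pow_mem (hg 3) 2)))
      (ofNat_mem _ _)
  have hc : (ofRoots x).inv12 / (ofRoots x).inv4 ^ 3 ∈ adjoin k (Set.range (generators x)) := hg 4
  have key : (resolvent (⟨_, hb⟩ : adjoin k (Set.range (generators x))) ⟨_, hc⟩).map
      (algebraMap _ K) = resolvent _ _ := resolvent_map _ _ _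
  refine ⟨(resolvent ⟨_, hb⟩ ⟨_, hc⟩).toPoly, natDegree_toPoly fun h0 ↦ ?_, fun i ↦ ?_⟩
  · refine h.resolvent_a0_ne ?_
    rw [show (ofRoots x).inv8 / _ = algebraMap (adjoin k (Set.range (generators x))) K ⟨_, hb⟩
      from rfl, show (ofRoots x).inv12 / _ =
      algebraMap (adjoin k (Set.range (generators x))) K ⟨_, hc⟩ from rfl, ← resolvent_map,
      BinaryQuintic.map, h0, map_zero]
  · rw [aeval_toPoly, key]
    exact h.eval_resolventRoot i

theorem isIntegral_resolventRoot (i : Fin 5) :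
    IsIntegral (adjoin k (Set.range (generators x))) (resolventRoot x i) := by
  obtain ⟨p, hp, hp0⟩ := h.exists_polynomial (k := k)
  exact IsAlgebraic.isIntegral ⟨p, by rintro rfl; simp at hp, hp0 i⟩

theorem adjoin_resolventRoot (htop : adjoin k (Set.range x) = ⊤) :
    Algebra.adjoin (adjoin k (Set.range (generators x))) (Set.range (resolventRoot x)) = ⊤ := by
  set F := adjoin k (Set.range (generators x))
  have hg (i : Fin 5) : generators x i ∈ adjoin F (Set.range (resolventRoot x)) :=
    IntermediateField.algebraMap_mem _ (⟨_, subset_adjoin k _ ⟨i, rfl⟩⟩ : F)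
  have hy (i : Fin 5) : resolventRoot x i ∈ adjoin F (Set.range (resolventRoot x)) :=
    subset_adjoin _ _ ⟨i, rfl⟩
  have hle : adjoin k (Set.range x) ≤
      (adjoin F (Set.range (resolventRoot x))).restrictScalars k := by
    rw [adjoin_le_iff]
    rintro _ ⟨i, rfl⟩
    rw [SetLike.mem_coe, mem_restrictScalars, h.eq_of_resolventRoot i]
    exact div_mem (sub_mem (mul_mem (hg 2) (hg 1)) (mul_mem (hg 0) (hy i)))
      (sub_mem (hy i) (hg 2))
  rw [htop, top_le_iff, restrictScalars_eq_top_iff] at hle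
  rw [← adjoin_toSubalgebra_of_isAlgebraic, hle, top_toSubalgebra]
  rintro _ ⟨i, rfl⟩
  exact (h.isIntegral_resolventRoot i).isAlgebraic

theorem isAlgebraic_generators (htop : adjoin k (Set.range x) = ⊤) :
    Algebra.IsAlgebraic (adjoin k (Set.range (generators x))) K := by
  have : adjoin (adjoin k (Set.range (generators x))) (Set.range (resolventRoot x)) = ⊤ := by
    rw [← toSubalgebra_inj, top_toSubalgebra, eq_top_iff, ← h.adjoin_resolventRoot htop]
    exact algebra_adjoin_le_adjoin _ _
  have halg : Algebra.IsAlgebraic (adjoin k (Set.range (generators x)))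
      (adjoin (adjoin k (Set.range (generators x))) (Set.range (resolventRoot x))) := by
    refine isAlgebraic_adjoin ?_
    rintro _ ⟨i, rfl⟩
    exact h.isIntegral_resolventRoot i
  rw [this] at halg
  exact topEquiv.isAlgebraic

theorem map_eq_of_map_resolventRoot
    (σ : K ≃ₐ[adjoin k (Set.range (generators x))] K) {π : Equiv.Perm (Fin 5)}
    (hσ : ∀ i, σ (resolventRoot x i) = resolventRoot x (π i)) (i : Fin 5) : σ (x i) = x (π i) := by
  have hg (i : Fin 5) : σ (generators x i) = generators x i :=
    σ.commutes ⟨_, subset_adjoin k _ ⟨i, rfl⟩⟩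
  rw [h.eq_of_resolventRoot i, h.eq_of_resolventRoot (π i)]
  simp [hg, hσ]

theorem sign_eq_one (σ : K ≃ₐ[adjoin k (Set.range (generators x))] K)
    {π : Equiv.Perm (Fin 5)} (hσ : ∀ i, σ (x i) = x (π i)) : Equiv.Perm.sign π = 1 := by
  have hg : σ (rootDisc x / (ofRoots x).inv4) = rootDisc x / (ofRoots x).inv4 :=
    σ.commutes ⟨_, subset_adjoin k _ ⟨3, rfl⟩⟩
  have hx : (σ : K →+* K) ∘ x = x ∘ π := funext hσ
  have h4 := inv4_map (σ : K →+* K) (ofRoots x)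
  rw [ofRoots_map, hx, ofRoots_comp_perm] at h4
  have hd := rootDisc_map (σ : K →+* K) x
  rw [hx, rootDisc_comp_perm] at hd
  simp only [RingHom.coe_coe] at h4 hd
  rw [map_div₀, ← h4, ← hd, div_left_inj' h.inv4_ne] at hg
  refine (Int.units_eq_one_or _).resolve_right fun hs ↦ h.rootDisc_ne ?_
  rw [hs] at hg
  refine (mul_eq_zero.1 ?_).resolve_left (two_ne_zero (α := K))
  push_cast at hg
  linear_combination -hg

theorem mem_adjoin_generators (htop : adjoin k (Set.range x) = ⊤) {m : K}
    (hm : ∀ (σ : K ≃ₐ[k] K) (π : Equiv.Perm (Fin 5)), Equiv.Perm.sign π = 1 →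
      (∀ i, σ (x i) = x (π i)) → σ m = m) : m ∈ adjoin k (Set.range (generators x)) := by
  obtain ⟨p, hp, hroot⟩ := h.exists_polynomial (k := k)
  obtain ⟨n, rfl⟩ := mem_range_algebraMap_of_forall_perm hp h.resolventRoot_injective hroot
    (by rintro rfl; simp at hp) (h.adjoin_resolventRoot htop) (m := m) fun σ π hσ ↦ by
      have hx := h.map_eq_of_map_resolventRoot σ hσ
      exact hm (σ.restrictScalars k) π (h.sign_eq_one σ hx) hx
  exact n.2

end Generic

end BinaryQuintic

open MvPolynomial

set_option synthInstance.maxHeartbeats 1000000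
set_option maxHeartbeats 1000000

/-- **Maeda's theorem for the natural representation of `A₅`.**
Let `k` be a field of characteristic zero and let the alternating group `A₅` act on
the rational function field `k(x₁,…,x₅)` by permuting the five variables (the action
`a` on the fraction field of `k[x₁,…,x₅]` sending `xᵢ` to `x_{g(i)}`).  Then the fixed
field `k(x₁,…,x₅)^{A₅}` is purely transcendental over `k`. -/
theorem invariant_field_of_A5_permutation_action_is_pure
    (k : Type) [Field k] [CharZero k]
    (a : (alternatingGroup (Fin 5)) →* (FractionRing (MvPolynomial (Fin 5) k) ≃ₐ[k]
      FractionRing (MvPolynomial (Fin 5) k)))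
    (ha : ∀ (g : alternatingGroup (Fin 5)) (i : Fin 5),
      a g (algebraMap (MvPolynomial (Fin 5) k) (FractionRing (MvPolynomial (Fin 5) k)) (X i)) =
        algebraMap (MvPolynomial (Fin 5) k) (FractionRing (MvPolynomial (Fin 5) k))
          (X ((g : Equiv.Perm (Fin 5)) i))) :
    ∃ t : ℕ, Nonempty
      ((IntermediateField.fixedField a.range) ≃ₐ[k]
        FractionRing (MvPolynomial (Fin t) k)) := by
  set K := FractionRing (MvPolynomial (Fin 5) k)
  set x : Fin 5 → K := algebraMap (MvPolynomial (Fin 5) k) K ∘ X with hx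
  have hinj : Function.Injective (algebraMap (MvPolynomial (Fin 5) k) K) :=
    IsFractionRing.injective _ _
  have h : BinaryQuintic.Generic x := (BinaryQuintic.generic_X k).map hinj
  have htop : IntermediateField.adjoin k (Set.range x) = ⊤ :=
    adjoin_range_algebraMap_X_s11 (Fin 5) k
  have hK : IntermediateField.fixedField a.range =
      IntermediateField.adjoin k (Set.range (BinaryQuintic.generators x)) := by
    refine le_antisymm (fun m hm ↦ ?_) (IntermediateField.adjoin_le_iff.2 ?_)
    · refine h.mem_adjoin_generators htop fun σ π hπ hσ ↦ ?_
      have : σ = a ⟨π, Equiv.Perm.mem_alternatingGroup.2 hπ⟩ := by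
        refine AlgEquiv.coe_toAlgHom_injective <|
          IsLocalization.algHom_ext (nonZeroDivisors (MvPolynomial (Fin 5) k)) ?_
        ext i
        exact (hσ i).trans (ha ⟨π, Equiv.Perm.mem_alternatingGroup.2 hπ⟩ i).symm
      rw [this]
      exact hm ⟨_, ⟨_, rfl⟩⟩
    · rintro _ ⟨i, rfl⟩ ⟨_, g, rfl⟩
      have hg : (a g : K →+* K) ∘ x = x ∘ (g : Equiv.Perm (Fin 5)) := funext (ha g)
      have := BinaryQuintic.generators_map (a g : K →+* K) x
      rw [hg, BinaryQuintic.generators_comp_perm x (Equiv.Perm.mem_alternatingGroup.1 g.2)] at this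
      exact (congrFun this i).symm
  have : Algebra.IsAlgebraic (IntermediateField.adjoin k
    (Set.range (BinaryQuintic.generators x))) K := h.isAlgebraic_generators htop
  have := (IntermediateField.isAlgebraic_adjoin_iff_top (F := k) (S := K)
    (s := Set.range (BinaryQuintic.generators x))).1 this
  have hind : AlgebraicIndependent k (BinaryQuintic.generators x) := by
    refine (Algebra.IsAlgebraic.isTranscendenceBasis_of_le_trdeg_of_finite k _ ?_).1
    exact ((algebraicIndependent_X (Fin 5) k).map'
      (f := IsScalarTower.toAlgHom k (MvPolynomial (Fin 5) k) K) hinj).cardinalMk_le_trdeg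
  exact ⟨5, ⟨(IntermediateField.equivOfEq hK).trans hind.aevalEquivField.symm⟩⟩
end

section
/- For every n ≥ 1, every element z of the center of the special linear group SL_n(ℂ) can be written as a commutator z = a·b·a⁻¹·b⁻¹ where a and b are elements of SL_n(ℂ) of finite order. -/
/-- Over an algebraically closed field, a matrix of finite order has a scalar multiple
which lies in the special linear group and is of finite order. -/
theorem Matrix.exists_smul_eq_coe_isOfFinOrder {ι K : Type*} [Fintype ι] [DecidableEq ι]
    [Nonempty ι] [Field K] [IsAlgClosed K] {M : Matrix ι ι K} (hM : IsOfFinOrder M) :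
    ∃ (c : K) (a : Matrix.SpecialLinearGroup ι K),
      (a : Matrix ι ι K) = c • M ∧ IsOfFinOrder a := by
  obtain ⟨k, hk, hMk⟩ := isOfFinOrder_iff_pow_eq_one.mp hM
  have hdet : M.det ^ k = 1 := by rw [← Matrix.det_pow, hMk, Matrix.det_one]
  have hdet0 : M.det ≠ 0 := by
    intro h
    simp [h, hk.ne'] at hdet
  obtain ⟨c, hc⟩ := IsAlgClosed.exists_pow_nat_eq M.det⁻¹ (Fintype.card_pos (α := ι))
  let a : Matrix.SpecialLinearGroup ι K :=
    ⟨c • M, by rw [Matrix.det_smul, hc, inv_mul_cancel₀ hdet0]⟩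
  have ha : (a : Matrix ι ι K) = c • M := rfl
  refine ⟨c, a, ha, isOfFinOrder_iff_pow_eq_one.mpr
    ⟨Fintype.card ι * k, Nat.mul_pos Fintype.card_pos hk, Subtype.ext ?_⟩⟩
  rw [Matrix.SpecialLinearGroup.coe_pow, Matrix.SpecialLinearGroup.coe_one, ha, smul_pow,
    pow_mul c, hc, inv_pow, hdet, inv_one, one_smul, mul_comm, pow_mul, hMk, one_pow]

/-- Permutation matrices have finite order. -/
theorem Matrix.isOfFinOrder_permMatrix {ι R : Type*} [Fintype ι] [DecidableEq ι] [Semiring R]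
    (σ : Equiv.Perm ι) :
    IsOfFinOrder (σ.permMatrix R) := by
  simpa using (Matrix.permMatrixHom (n := ι) (R := R)).isOfFinOrder (isOfFinOrder_of_finite σ⁻¹)

/-- The clock and shift matrices commute up to the root of unity `r`. -/
theorem Matrix.diagonal_pow_mul_permMatrix {K : Type*} [CommRing K] {m : ℕ} {r : K}
    (hr : r ^ (m + 1) = 1) :
    Matrix.diagonal (fun i : Fin (m + 1) => r ^ (i : ℕ)) *
        Equiv.Perm.permMatrix K (Equiv.subRight (1 : Fin (m + 1))) =
      r • (Equiv.Perm.permMatrix K (Equiv.subRight (1 : Fin (m + 1))) *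
        Matrix.diagonal (fun i : Fin (m + 1) => r ^ (i : ℕ))) := by
  ext i j
  obtain ⟨i, rfl⟩ := (Equiv.addRight (1 : Fin (m + 1))).surjective i
  have hi : r ^ ((i + 1 : Fin (m + 1)) : ℕ) = r * r ^ (i : ℕ) := by
    rw [Fin.val_add, ← pow_eq_pow_mod _ hr, pow_add, mul_comm, Fin.val_one',
      ← pow_eq_pow_mod _ hr, pow_one]
  by_cases hij : i = j
  · subst hij
    simp [Matrix.diagonal_mul, Matrix.mul_diagonal, PEquiv.toMatrix_apply, hi]
  · simp [Matrix.diagonal_mul, Matrix.mul_diagonal, PEquiv.toMatrix_apply, hij]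

/-- For every `n ≥ 1`, every element `z` of the center of `SL_n(ℂ)`
is a commutator `z = a * b * a⁻¹ * b⁻¹` of elements `a`, `b` of `SL_n(ℂ)` of finite
order. -/
theorem center_SL_is_commutator_of_finite_order_elements
    (n : ℕ) (hn : 1 ≤ n)
    (z : Matrix.SpecialLinearGroup (Fin n) ℂ)
    (hz : z ∈ Subgroup.center (Matrix.SpecialLinearGroup (Fin n) ℂ)) :
    ∃ a b : Matrix.SpecialLinearGroup (Fin n) ℂ,
      IsOfFinOrder a ∧ IsOfFinOrder b ∧ z = a * b * a⁻¹ * b⁻¹ := by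
  obtain ⟨m, rfl⟩ : ∃ m, n = m + 1 := ⟨n - 1, by omega⟩
  obtain ⟨r, hr, hrz⟩ := Matrix.SpecialLinearGroup.mem_center_iff.mp hz
  rw [Fintype.card_fin] at hr
  have hclock : IsOfFinOrder (Matrix.diagonal (fun i : Fin (m + 1) => r ^ (i : ℕ))) := by
    refine isOfFinOrder_iff_pow_eq_one.mpr ⟨m + 1, m.succ_pos, ?_⟩
    rw [Matrix.diagonal_pow, ← Matrix.diagonal_one]
    congr 1
    ext i
    simp [← pow_mul, mul_comm (i : ℕ), pow_mul r (m + 1), hr]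
  obtain ⟨c, a, hca, ha⟩ := Matrix.exists_smul_eq_coe_isOfFinOrder hclock
  obtain ⟨d, b, hdb, hb⟩ := Matrix.exists_smul_eq_coe_isOfFinOrder
    (Matrix.isOfFinOrder_permMatrix (R := ℂ) (Equiv.subRight (1 : Fin (m + 1))))
  refine ⟨a, b, ha, hb, ?_⟩
  rw [eq_mul_inv_iff_mul_eq, eq_mul_inv_iff_mul_eq]
  apply Subtype.ext
  rw [Matrix.SpecialLinearGroup.coe_mul, Matrix.SpecialLinearGroup.coe_mul,
    Matrix.SpecialLinearGroup.coe_mul, ← hrz, hca, hdb, smul_mul_smul_comm,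
    Matrix.diagonal_pow_mul_permMatrix hr, Matrix.mul_assoc, smul_mul_smul_comm,
    Matrix.scalar_apply, ← Matrix.smul_eq_diagonal_mul, smul_comm, mul_comm d]
end

section
/- Let k be an infinite field and let K be a finitely generated field extension of k. If there exists a k-algebra embedding of K into a purely transcendental extension k(t_1,…,t_n) of k for some n, then there exists a k-algebra embedding of K into a purely transcendental extension k(t_1,…,t_d) of k with d equal to the transcendence degree of K over k. -/
open MvPolynomial

/-- A homomorphism from a domain `R` to a field `F` extends to a subalgebra of the fraction field
of `R` containing all fractions whose denominator does not map to zero. -/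
lemma exists_subalgebra_extension_of_fractionRing {k R L F : Type*} [Field k] [CommRing R]
    [IsDomain R] [Algebra k R] [Field L] [Algebra R L] [IsFractionRing R L] [Algebra k L]
    [IsScalarTower k R L] [Field F] [Algebra k F] (ψ : R →ₐ[k] F) :
    ∃ (B : Subalgebra k L) (φ : B →ₐ[k] F),
      (∀ p : R, ∃ h : algebraMap R L p ∈ B, φ ⟨algebraMap R L p, h⟩ = ψ p) ∧
      ∀ a b : R, ψ b ≠ 0 → algebraMap R L a / algebraMap R L b ∈ B := by
  let S : Submonoid R := (nonZeroDivisors F).comap ψ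
  have hmem (b : R) : b ∈ S ↔ ψ b ≠ 0 := by
    simp [S]
  have hS : S ≤ nonZeroDivisors R := fun b hb ↦
    mem_nonZeroDivisors_of_ne_zero fun h ↦ (hmem b).1 hb (by simp [h])
  let B := Localization.subalgebra.ofField L S hS
  have hunit (y : S) : IsUnit (ψ y) := ((hmem y).1 y.2).isUnit
  let φ : B →+* F := IsLocalization.lift (M := S) (g := (ψ : R →+* F)) hunit
  have hφ (p : R) : φ (algebraMap R B p) = ψ p := IsLocalization.lift_eq hunit p
  have hcomm (r : k) : φ (algebraMap k (B.restrictScalars k) r) = algebraMap k F r := by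
    rw [← ψ.commutes r, ← hφ]
    exact congrArg φ (Subtype.ext (IsScalarTower.algebraMap_apply k R L r))
  exact ⟨B.restrictScalars k, { φ with commutes' := hcomm },
    fun p ↦ ⟨B.algebraMap_mem p, hφ p⟩, fun a b hb ↦ ⟨a, b, (hmem b).2 hb, div_eq_mul_inv _ _⟩⟩

/-- The substitution of the constants `c i` for the variables indexed by `J`. -/
noncomputable def MvPolynomial.partialEval {k ι : Type*} [CommRing k] (J : Set ι) (c : ι → k) :
    MvPolynomial ι k →ₐ[k] MvPolynomial ↥Jᶜ k :=
  open scoped Classical in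
  aeval fun i ↦ if h : i ∈ J then C (c i) else X ⟨i, h⟩

lemma MvPolynomial.aeval_partialEval {k ι : Type*} [CommRing k] (J : Set ι) (c : ι → k)
    (p : MvPolynomial ι k) :
    aeval (fun i : ↥Jᶜ ↦ c i) (partialEval J c p) = aeval c p := by
  rw [← AlgHom.comp_apply]
  congr 1
  ext i
  by_cases h : i ∈ J <;> simp [partialEval, h]

/-- Over an infinite field, finitely many rational functions can be specialized simultaneously in
the variables indexed by `J`, without making the nonzero ones among them vanish. -/
lemma MvPolynomial.exists_specialization {k ι L : Type*} [Field k] [Infinite k] [Field L]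
    [Algebra (MvPolynomial ι k) L] [IsFractionRing (MvPolynomial ι k) L] [Algebra k L]
    [IsScalarTower k (MvPolynomial ι k) L] (J : Set ι) (T : Finset L) :
    ∃ (c : ι → k) (B : Subalgebra k L) (φ : B →ₐ[k] FractionRing (MvPolynomial ↥Jᶜ k)),
      (∀ p : MvPolynomial ι k, ∃ h : algebraMap _ _ p ∈ B,
        φ ⟨algebraMap _ _ p, h⟩ = algebraMap _ _ (partialEval J c p)) ∧
      ∀ x ∈ T, ∃ h : x ∈ B, x ≠ 0 → φ ⟨x, h⟩ ≠ 0 := by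
  classical
  have hfrac (x : L) : ∃ a b : MvPolynomial ι k, b ≠ 0 ∧
      x = algebraMap _ L a / algebraMap _ L b := by
    obtain ⟨a, b, hb, h⟩ := IsFractionRing.div_surjective (MvPolynomial ι k) x
    exact ⟨a, b, nonZeroDivisors.ne_zero hb, h.symm⟩
  choose num den hden hdiv using hfrac
  let q : MvPolynomial ι k := ∏ x ∈ T, (den x * if num x = 0 then 1 else num x)
  have hq : q ≠ 0 := Finset.prod_ne_zero_iff.2 fun x _ ↦
    mul_ne_zero (hden x) (by split_ifs with h <;> simp [h])
  obtain ⟨c, hc⟩ : ∃ c : ι → k, aeval c q ≠ 0 := by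
    by_contra! h
    exact hq (MvPolynomial.funext fun c ↦ by simpa [aeval_eq_eval] using h c)
  have hfactor (x) (hx : x ∈ T) :
      aeval c (den x) ≠ 0 ∧ (num x ≠ 0 → aeval c (num x) ≠ 0) := by
    rw [map_prod, Finset.prod_ne_zero_iff] at hc
    have h := hc x hx
    rw [map_mul, mul_ne_zero_iff] at h
    exact ⟨h.1, fun hn ↦ by simpa only [if_neg hn] using h.2⟩
  let ψ : MvPolynomial ι k →ₐ[k] FractionRing (MvPolynomial ↥Jᶜ k) :=
    (IsScalarTower.toAlgHom k (MvPolynomial ↥Jᶜ k) _).comp (partialEval J c)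
  have hψ (p : MvPolynomial ι k) (hp : aeval c p ≠ 0) : ψ p ≠ 0 := by
    intro h
    apply hp
    have h0 : partialEval J c p = 0 :=
      IsFractionRing.injective (MvPolynomial ↥Jᶜ k) (FractionRing (MvPolynomial ↥Jᶜ k))
        (by simpa [ψ] using h)
    rw [← aeval_partialEval J c p, h0, map_zero]
  obtain ⟨B, φ, hφ, hB⟩ := exists_subalgebra_extension_of_fractionRing (L := L) ψ
  refine ⟨c, B, φ, hφ, fun x hx ↦ ?_⟩
  obtain ⟨hd, hn⟩ := hfactor x hx
  have hxB : x ∈ B := by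
    rw [hdiv x]
    exact hB _ _ (hψ _ hd)
  refine ⟨hxB, fun hx0 h0 ↦ ?_⟩
  have hdL : algebraMap _ L (den x) ≠ 0 :=
    (map_ne_zero_iff _ (IsFractionRing.injective (MvPolynomial ι k) L)).2 (hden x)
  obtain ⟨hnB, hnφ⟩ := hφ (num x)
  obtain ⟨hdB, -⟩ := hφ (den x)
  have hmul : (⟨x, hxB⟩ : B) * ⟨_, hdB⟩ = ⟨_, hnB⟩ :=
    Subtype.ext ((eq_div_iff hdL).1 (hdiv x))
  have hnum : num x ≠ 0 := fun h ↦ hx0 (by rw [hdiv x, h, map_zero, zero_div])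
  apply hψ _ (hn hnum)
  rw [← hnφ, ← hmul, map_mul, h0, zero_mul]

/-- An algebra homomorphism that maps a transcendence basis of a domain to an algebraically
independent family is injective. -/
lemma IsTranscendenceBasis.injective_of_algebraicIndependent_comp {k ι A F : Type*} [Field k]
    [CommRing A] [IsDomain A] [Algebra k A] [CommRing F] [Algebra k F] {s : ι → A}
    (hs : IsTranscendenceBasis k s) (f : A →ₐ[k] F) (hf : AlgebraicIndependent k (f ∘ s)) :
    Function.Injective f := by
  rw [injective_iff_map_eq_zero]
  intro a ha
  by_contra h
  have := hs.isAlgebraic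
  obtain ⟨⟨r, hr⟩, hr0, t, ht⟩ := (Algebra.IsAlgebraic.isAlgebraic
    (R := Algebra.adjoin k (Set.range s)) a).exists_nonzero_dvd (mem_nonZeroDivisors_of_ne_zero h)
  have hfr : f r = 0 := by
    have : r = a * t := ht
    rw [this, map_mul, ha, zero_mul]
  rw [Algebra.adjoin_range_eq_range_aeval] at hr
  obtain ⟨p, rfl⟩ := hr
  have hp : p = 0 := (injective_iff_map_eq_zero _).1 hf p (by
    rw [← hfr]
    exact (comp_aeval_apply s f p).symm)
  exact hr0 (Subtype.ext (by simp [hp]))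

/-- Algebraicity over a generated subalgebra is preserved by homomorphisms defined on a subalgebra,
provided the leading coefficient of the algebraic relation does not map to zero. -/
lemma isAlgebraic_map_of_leadingCoeff {k L F : Type*} [Field k] [CommRing L] [Algebra k L]
    [CommRing F] [Algebra k F] {B : Subalgebra k L} (φ : B →ₐ[k] F) (D : Subalgebra k L)
    (E : Subalgebra k F) (hDB : D ≤ B) (hDE : ∀ x (hx : x ∈ D), φ ⟨x, hDB hx⟩ ∈ E)
    {y : L} (hy : y ∈ B) (p : Polynomial D) (hp : Polynomial.aeval y p = 0)
    (hlead : φ ⟨p.leadingCoeff, hDB p.leadingCoeff.2⟩ ≠ 0) :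
    IsAlgebraic E (φ ⟨y, hy⟩) := by
  let g : D →ₐ[k] E := (φ.comp (Subalgebra.inclusion hDB)).codRestrict E fun x ↦ hDE x x.2
  refine ⟨p.map (g : D →+* E), fun h ↦ hlead ?_, ?_⟩
  · have h0 : g p.leadingCoeff = 0 := by
      simpa using congrArg (fun q ↦ q.coeff p.natDegree) h
    exact congrArg Subtype.val h0
  · have hB : Polynomial.eval₂ (Subalgebra.inclusion hDB : D →+* B) ⟨y, hy⟩ p = 0 := by
      apply Subtype.val_injective
      have := Polynomial.hom_eval₂ p (Subalgebra.inclusion hDB : D →+* B) (B.val : B →+* L) ⟨y, hy⟩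
      exact this.trans hp
    rw [Polynomial.aeval_def, Polynomial.eval₂_map]
    have := Polynomial.hom_eval₂ p (Subalgebra.inclusion hDB : D →+* B) (φ : B →+* F) ⟨y, hy⟩
    rw [hB, map_zero] at this
    exact this.symm

lemma MvPolynomial.isTranscendenceBasis_algebraMap_comp_X {k ι L : Type*} [Field k] [Field L]
    [Algebra (MvPolynomial ι k) L] [IsFractionRing (MvPolynomial ι k) L] [Algebra k L]
    [IsScalarTower k (MvPolynomial ι k) L] :
    IsTranscendenceBasis k (algebraMap (MvPolynomial ι k) L ∘ X) :=
  have : Algebra.IsAlgebraic (MvPolynomial ι k) L :=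
    (IsFractionRing.comap_isAlgebraic_iff (K := L)).mpr inferInstance
  (IsTranscendenceBasis.mvPolynomial ι k).algebraMap_comp

/-- An algebraically independent family of rational functions can be completed to a transcendence
basis by some of the variables; the number of the remaining variables is the size of the family. -/
lemma MvPolynomial.exists_isAlgebraic_adjoin_union_X {k ι κ L : Type*} [Field k] [Finite ι]
    [Finite κ] [Field L] [Algebra (MvPolynomial ι k) L] [IsFractionRing (MvPolynomial ι k) L]
    [Algebra k L] [IsScalarTower k (MvPolynomial ι k) L] (s : κ → L)
    (hs : AlgebraicIndependent k s) :
    ∃ J : Set ι, Nat.card ↥Jᶜ = Nat.card κ ∧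
      Algebra.IsAlgebraic (Algebra.adjoin k (Set.range s ∪
        (fun i ↦ algebraMap (MvPolynomial ι k) L (X i)) '' J)) L := by
  let t : ι → L := algebraMap (MvPolynomial ι k) L ∘ X
  have ht : IsTranscendenceBasis k t := isTranscendenceBasis_algebraMap_comp_X
  have : Algebra.IsAlgebraic (Algebra.adjoin k (Set.range s ∪ Set.range t)) L := by
    rw [ht.isAlgebraic_iff]
    exact fun i ↦ isAlgebraic_algebraMap (A := L)
      (⟨t i, Algebra.subset_adjoin (.inr ⟨i, rfl⟩)⟩ : Algebra.adjoin k _)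
  obtain ⟨u, hsu, hut, hu⟩ := exists_isTranscendenceBasis_between (R := k) (Set.range s)
    (Set.range s ∪ Set.range t) Set.subset_union_left hs.to_subtype_range
  let J : Set ι := t ⁻¹' (u \ Set.range s)
  have hJ : t '' J = u \ Set.range s := by
    refine Set.image_preimage_eq_of_subset fun x hx ↦ ?_
    exact (hut hx.1).resolve_left hx.2
  refine ⟨J, ?_, ?_⟩
  · have h1 : Nat.card ι = u.ncard := by
      simpa [Nat.card, ← Nat.card_coe_set_eq] using
        congrArg Cardinal.toNat (ht.lift_cardinalMk_eq hu)
    have h2 : (u \ Set.range s).ncard = J.ncard := by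
      rw [← hJ, Set.ncard_image_of_injective _ ht.1.injective]
    have h3 : (Set.range s).ncard = Nat.card κ := by
      rw [← Nat.card_coe_set_eq, Nat.card_range_of_injective hs.injective]
    have hfin : u.Finite := ((Set.finite_range s).union (Set.finite_range t)).subset hut
    have h4 := Set.ncard_sdiff_add_ncard_of_subset hsu hfin
    have h5 := Set.ncard_add_ncard_compl J
    rw [Nat.card_coe_set_eq]
    omega
  · have hunion : Set.range s ∪ (fun i ↦ algebraMap (MvPolynomial ι k) L (X i)) '' J = u := by
      change Set.range s ∪ t '' J = u
      rw [hJ, Set.union_sdiff_cancel hsu]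
    rw [hunion]
    have := hu.isAlgebraic
    rwa [Subtype.range_coe] at this

/-- A finitely generated field that embeds in a purely transcendental extension of an infinite
field embeds in the one generated by suitable variables, as many as its transcendence degree. -/
lemma MvPolynomial.exists_algHom_fractionRing_compl {k K ι κ L : Type*} [Field k] [Infinite k]
    [Field L] [Algebra (MvPolynomial ι k) L] [IsFractionRing (MvPolynomial ι k) L]
    [Algebra k L] [IsScalarTower k (MvPolynomial ι k) L] [Field K] [Algebra k K]
    (hfg : (⊤ : IntermediateField k K).FG) [Finite ι] [Finite κ] (emb : K →ₐ[k] L) (s : κ → K) (hs : IsTranscendenceBasis k s) :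
    ∃ J : Set ι, Nat.card ↥Jᶜ = Nat.card κ ∧
      Nonempty (K →ₐ[k] FractionRing (MvPolynomial ↥Jᶜ k)) := by
  classical
  cases nonempty_fintype ι
  cases nonempty_fintype κ
  let t : ι → L := fun i ↦ algebraMap (MvPolynomial ι k) L (X i)
  obtain ⟨J, hJ, halg⟩ := exists_isAlgebraic_adjoin_union_X (ι := ι) (emb ∘ s)
    (hs.1.map' emb.injective)
  refine ⟨J, hJ, ?_⟩
  let F := FractionRing (MvPolynomial ↥Jᶜ k)
  let D : Subalgebra k L := Algebra.adjoin k (Set.range (emb ∘ s) ∪ t '' J)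
  choose p hp0 hp using fun i ↦ halg.isAlgebraic (t i)
  obtain ⟨G, hG⟩ := hfg
  obtain ⟨c, B, φ, hφ, hT⟩ := exists_specialization (k := k) J
    (G.image emb ∪ Finset.univ.image (emb ∘ s) ∪
      Finset.univ.image fun i ↦ ((p i).leadingCoeff : L))
  have hGB (x) (hx : x ∈ G) : emb x ∈ B := (hT _ (by simp; grind)).1
  have hsB (i) : emb (s i) ∈ B := (hT _ (by simp)).1
  have hDB : D ≤ B := by
    refine Algebra.adjoin_le ?_
    rintro _ (⟨i, rfl⟩ | ⟨i, -, rfl⟩)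
    · exact hsB i
    · exact (hφ (X i)).1
  let σ : κ → F := fun i ↦ φ ⟨emb (s i), hsB i⟩
  let E : Subalgebra k F := Algebra.adjoin k (Set.range σ)
  have hDE (x : L) (hx : x ∈ D) : φ ⟨x, hDB hx⟩ ∈ E := by
    have hle : D ≤ (E.comap φ).map B.val := by
      refine Algebra.adjoin_le ?_
      rintro _ (⟨i, rfl⟩ | ⟨i, hi, rfl⟩)
      · exact ⟨⟨_, hsB i⟩, Algebra.subset_adjoin ⟨i, rfl⟩, rfl⟩
      · obtain ⟨h, he⟩ := hφ (X i)
        refine ⟨⟨_, h⟩, ?_, rfl⟩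
        change φ _ ∈ E
        rw [he]
        simp only [partialEval, aeval_X, dif_pos hi]
        exact E.algebraMap_mem (c i)
    obtain ⟨⟨y, hy⟩, hyE, rfl⟩ := hle hx
    exact hyE
  have hbasis : IsTranscendenceBasis k (algebraMap (MvPolynomial ↥Jᶜ k) F ∘ X) :=
    
    isTranscendenceBasis_algebraMap_comp_X
  have halgF : Algebra.IsAlgebraic E F := by
    rw [hbasis.isAlgebraic_iff]
    rintro ⟨i, hi⟩
    obtain ⟨h, he⟩ := hφ (X i)
    have hlead := (hT (p i).leadingCoeff (by simp)).2 (by simpa using hp0 i)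
    have := isAlgebraic_map_of_leadingCoeff φ D E hDB hDE h (p i) (hp i) hlead
    rw [he] at this
    simp only [partialEval, aeval_X, dif_neg hi] at this
    exact this
  have hσ : AlgebraicIndependent k σ := by
    refine (Algebra.IsAlgebraic.isTranscendenceBasis_of_lift_le_trdeg_of_finite k σ ?_).1
    exact (hbasis.comp_equiv (Finite.card_eq.1 hJ.symm).some).lift_cardinalMk_eq_trdeg.le
  let A : Subalgebra k K := B.comap emb
  let f : A →ₐ[k] F := φ.comp ((emb.comp A.val).codRestrict B fun x ↦ x.2)
  have hf : Function.Injective f := by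
    let s' : κ → A := fun i ↦ ⟨s i, hsB i⟩
    have hs' : IsTranscendenceBasis k s' := .of_comp A.val Subtype.val_injective hs
    exact hs'.injective_of_algebraicIndependent_comp f hσ
  have : IsFractionRing A K := by
    refine IsFractionRing.of_field A K fun z ↦ ?_
    have hz : z ∈ IntermediateField.adjoin k (G : Set K) := hG ▸ IntermediateField.mem_top
    obtain ⟨x, hx, y, hy, rfl⟩ := IntermediateField.mem_adjoin_iff_div.1 hz
    have hle : Algebra.adjoin k (G : Set K) ≤ A := Algebra.adjoin_le hGB
    exact ⟨⟨x, hle hx⟩, ⟨y, hle hy⟩, rfl⟩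
  exact ⟨IsFractionRing.liftAlgHom hf⟩

/-- Let `k` be an infinite field and `K` a finitely generated field
extension of `k`.  If `K` embeds (as a `k`-algebra) into a purely transcendental
extension `k(t₁, …, tₙ)` of `k` for some `n`, then `K` embeds into a purely
transcendental extension `k(t₁, …, t_d)` of `k`, where `d` is the transcendence degree
of `K` over `k` (witnessed by a transcendence basis indexed by `Fin d`). -/
theorem unirational_embeds_in_pure_extension_of_transcendence_degree
    {k K : Type*} [Field k] [Infinite k] [Field K] [Algebra k K]
    (hfg : (⊤ : IntermediateField k K).FG)
    {n : ℕ} (emb : K →ₐ[k] FractionRing (MvPolynomial (Fin n) k))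
    {d : ℕ} (s : Fin d → K) (hs : IsTranscendenceBasis k s) :
    Nonempty (K →ₐ[k] FractionRing (MvPolynomial (Fin d) k)) := by
  obtain ⟨J, hJ, ⟨f⟩⟩ := exists_algHom_fractionRing_compl (ι := Fin n) hfg emb s hs
  let e : ↥Jᶜ ≃ Fin d := Finite.equivFinOfCardEq (hJ.trans (Nat.card_fin d))
  exact ⟨(IsFractionRing.fieldEquivOfAlgEquiv k (FractionRing (MvPolynomial ↥Jᶜ k))
    (FractionRing (MvPolynomial (Fin d) k)) (renameEquiv k e)).toAlgHom.comp f⟩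
end

section
/- (Saltman's characterization of retract rationality.) Let k be a field of characteristic zero and X an integral variety over k. The following conditions are equivalent: (i) there exists a nonempty open subscheme U of X, an integer n, a nonempty open subscheme Y of affine n-space 𝔸ⁿ_k, and k-morphisms U → Y and Y → U whose composite U → Y → U is the identity morphism of U; (ii) there exists a nonempty open subscheme V of X such that for every local k-algebra A with residue field κ, the natural map V(A) → V(κ) on points is surjective, i.e. every k-morphism Spec κ → V extends to a k-morphism Spec A → V. -/
open AlgebraicGeometry CategoryTheory

/-- A morphism from the spectrum of a local ring factors through an open as soon as
its restriction to the residue field does. -/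
theorem range_subset_of_residue_comp {A : Type} [CommRing A] [IsLocalRing A] {T X : Scheme}
    (j : T ⟶ X) [IsOpenImmersion j] (ψ : Spec (CommRingCat.of A) ⟶ X)
    (φ : Spec (CommRingCat.of (IsLocalRing.ResidueField A)) ⟶ T)
    (h : Spec.map (CommRingCat.ofHom (IsLocalRing.residue A)) ≫ ψ = φ ≫ j) :
    Set.range ψ ⊆ Set.range j := by
  have hc : IsLocalRing.closedPoint A ∈ ψ ⁻¹ᵁ j.opensRange := by
    let p : Spec (CommRingCat.of (IsLocalRing.ResidueField A)) :=
      IsLocalRing.closedPoint (IsLocalRing.ResidueField A)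
    have hp : (Spec.map (CommRingCat.ofHom (IsLocalRing.residue A))) p =
        IsLocalRing.closedPoint A := IsLocalRing.PrimeSpectrum.comap_residue A p
    refine ⟨φ p, ?_⟩
    rw [← hp, ← Scheme.Hom.comp_apply, ← Scheme.Hom.comp_apply, h]
  rintro _ ⟨x, rfl⟩
  exact (IsLocalRing.specializes_closedPoint x).mem_open (ψ ⁻¹ᵁ j.opensRange).2 hc

/-- Affine space over `k` satisfies the lifting property for local `k`-algebras. -/
theorem exists_lift_mvPolynomial {k A : Type} [Field k] [CommRing A] [IsLocalRing A]
    [Algebra k A] {σ : Type}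
    (φ : Spec (CommRingCat.of (IsLocalRing.ResidueField A)) ⟶
      Spec (CommRingCat.of (MvPolynomial σ k)))
    (hφ : φ ≫ Spec.map (CommRingCat.ofHom (algebraMap k (MvPolynomial σ k))) =
      Spec.map (CommRingCat.ofHom (algebraMap k (IsLocalRing.ResidueField A)))) :
    ∃ ψ : Spec (CommRingCat.of A) ⟶ Spec (CommRingCat.of (MvPolynomial σ k)),
      ψ ≫ Spec.map (CommRingCat.ofHom (algebraMap k (MvPolynomial σ k))) =
        Spec.map (CommRingCat.ofHom (algebraMap k A)) ∧
      Spec.map (CommRingCat.ofHom (IsLocalRing.residue A)) ≫ ψ = φ := by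
  obtain ⟨g, rfl⟩ := Spec.map_surjective φ
  rw [← Spec.map_comp] at hφ
  have hg := congrArg CommRingCat.Hom.hom (Spec.map_injective hφ)
  simp only [CommRingCat.hom_comp, CommRingCat.hom_ofHom] at hg
  choose y hy using fun i => IsLocalRing.residue_surjective (g.hom (MvPolynomial.X i))
  refine ⟨Spec.map (CommRingCat.ofHom (MvPolynomial.aeval (R := k) y).toRingHom), ?_, ?_⟩
  · rw [← Spec.map_comp, ← CommRingCat.ofHom_comp]
    congr 2
    ext c
    simp
  · rw [← Spec.map_comp]
    congr 1
    ext1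
    refine MvPolynomial.ringHom_ext (fun c => ?_) fun i => ?_
    · simpa [IsScalarTower.algebraMap_apply k A (IsLocalRing.ResidueField A)] using
        (RingHom.congr_fun hg c).symm
    · simpa using hy i

/-- A `k`-algebra morphism of finite type into a localization of a polynomial ring spreads out:
if a finitely generated domain `R = k[x]/I` maps to `k[x]_I` compatibly with the residue field,
then it already maps to some `k[x]_f` with nonzero image `π f` in `R`, compatibly with `R_f`. -/
theorem exists_away_lift {k R : Type} [Field k] [CommRing R] [IsDomain R] [Algebra k R]
    {n : ℕ} (π : MvPolynomial (Fin n) k →ₐ[k] R) (I : Ideal (MvPolynomial (Fin n) k))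
    [I.IsPrime] (hI : RingHom.ker π = I) (hπ : Function.Surjective π)
    (e : R →+* I.ResidueField)
    (he : e.comp π.toRingHom = algebraMap (MvPolynomial (Fin n) k) I.ResidueField)
    (s : R →ₐ[k] Localization.AtPrime I)
    (hs : (IsLocalRing.residue (Localization.AtPrime I)).comp s.toRingHom = e) :
    ∃ (f : MvPolynomial (Fin n) k) (t : R →ₐ[k] Localization.Away f), π f ≠ 0 ∧
      (IsLocalization.Away.map (Localization.Away f) (Localization.Away (π f))
        π.toRingHom f).comp t.toRingHom = algebraMap R (Localization.Away (π f)) := by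
  obtain ⟨⟨f, hfI⟩, hf⟩ := IsLocalization.exist_integer_multiples_of_finite I.primeCompl
    (fun i : Fin n => s (π (MvPolynomial.X i)))
  have hπf : π f ≠ 0 := fun h => hfI (hI ▸ h)
  have hu : IsUnit (algebraMap (MvPolynomial (Fin n) k) (Localization.AtPrime I) f) :=
    IsLocalization.map_units (Localization.AtPrime I) (⟨f, hfI⟩ : I.primeCompl)
  let ι₀ : Localization.Away f →+* Localization.AtPrime I := IsLocalization.Away.lift f hu
  have hι₀ (x) : ι₀ (algebraMap _ _ x) = algebraMap _ _ x := IsLocalization.Away.lift_eq f hu x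
  let ι : Localization.Away f →ₐ[k] Localization.AtPrime I :=
    { ι₀ with
      commutes' := fun c => by
        have := hι₀ (algebraMap k _ c)
        rwa [← IsScalarTower.algebraMap_apply, ← IsScalarTower.algebraMap_apply] at this }
  have hι (x) : ι (algebraMap _ _ x) = algebraMap _ _ x := hι₀ x
  have hinj : Function.Injective ι := by
    refine (injective_iff_map_eq_zero ι).2 fun z hz => ?_
    obtain ⟨x, m, rfl⟩ := IsLocalization.exists_mk'_eq (Submonoid.powers f) z
    have h0 : ι (algebraMap _ _ x) = 0 := by
      rw [← IsLocalization.mk'_spec (Localization.Away f) x m, map_mul, hz, zero_mul]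
    rw [hι, IsLocalization.to_map_eq_zero_iff _ I.primeCompl_le_nonZeroDivisors] at h0
    simp [h0]
  have hrange : ∀ r, s r ∈ ι.range := by
    intro r
    obtain ⟨p, rfl⟩ := hπ r
    have hX : (s.comp π).range ≤ ι.range := by
      rw [← Algebra.map_top, ← MvPolynomial.adjoin_range_X, AlgHom.map_adjoin,
        Algebra.adjoin_le_iff]
      rintro _ ⟨_, ⟨i, rfl⟩, rfl⟩
      obtain ⟨q, hq⟩ := hf i
      refine ⟨IsLocalization.mk' _ q (⟨f, Submonoid.mem_powers f⟩ : Submonoid.powers f), ?_⟩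
      apply hu.mul_left_cancel
      rw [← hι, AlgHom.toRingHom_eq_coe, RingHom.coe_coe, ← map_mul,
        IsLocalization.mk'_spec'_mk, hι, hι, hq, Algebra.smul_def]
      rfl
    exact hX ⟨p, rfl⟩
  let t : R →ₐ[k] Localization.Away f :=
    (AlgEquiv.ofInjective ι hinj).symm.toAlgHom.comp (s.codRestrict ι.range hrange)
  have ht (r) : ι (t r) = s r :=
    congrArg Subtype.val ((AlgEquiv.ofInjective ι hinj).apply_symm_apply ⟨s r, hrange r⟩)
  refine ⟨f, t, hπf, ?_⟩
  have he_inj : Function.Injective e := by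
    refine (injective_iff_map_eq_zero e).2 fun r hr => ?_
    obtain ⟨p, rfl⟩ := hπ r
    have hp : algebraMap _ I.ResidueField p = 0 := (RingHom.congr_fun he p).symm.trans hr
    rw [Ideal.algebraMap_residueField_eq_zero, ← hI] at hp
    exact hp
  have heu : IsUnit (e (π f)) := isUnit_iff_ne_zero.2 ((map_ne_zero_iff e he_inj).2 hπf)
  let ε : Localization.Away (π f) →+* I.ResidueField := IsLocalization.Away.lift (π f) heu
  have hε (r) : ε (algebraMap _ _ r) = e r := IsLocalization.Away.lift_eq (π f) heu r
  have hε_inj : Function.Injective ε := by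
    refine (injective_iff_map_eq_zero ε).2 fun z hz => ?_
    obtain ⟨x, m, rfl⟩ := IsLocalization.exists_mk'_eq (Submonoid.powers (π f)) z
    have h0 : ε (algebraMap _ _ x) = 0 := by
      rw [← IsLocalization.mk'_spec (Localization.Away (π f)) x m, map_mul, hz, zero_mul]
    rw [hε, map_eq_zero_iff e he_inj] at h0
    simp [h0]
  have hcomp : ε.comp (IsLocalization.Away.map (Localization.Away f) (Localization.Away (π f))
      π.toRingHom f) = (IsLocalRing.residue _).comp ι.toRingHom := by
    refine IsLocalization.ringHom_ext (Submonoid.powers f) (RingHom.ext fun p => ?_)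
    have h1 : IsLocalization.Away.map (Localization.Away f) (Localization.Away (π f))
      π.toRingHom f (algebraMap _ _ p) = algebraMap _ _ (π p) := IsLocalization.map_eq _ _
    change ε (IsLocalization.Away.map (Localization.Away f) (Localization.Away (π f))
      π.toRingHom f (algebraMap _ _ p)) = IsLocalRing.residue _ (ι (algebraMap _ _ p))
    rw [h1, hε, hι]
    exact RingHom.congr_fun he p
  refine RingHom.ext fun r => hε_inj ?_
  refine (RingHom.congr_fun hcomp (t r)).trans ?_
  rw [hε, ← hs]
  exact congrArg _ (ht r)

/-- Retract data between schemes embedded as opens can be transported to their images. -/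
theorem exists_retract_of_isOpenImmersion {S X P T Z : Scheme} (sX : X ⟶ S) (sP : P ⟶ S)
    (j : T ⟶ X) (i : Z ⟶ P) [IsOpenImmersion j] [IsOpenImmersion i] [Nonempty T]
    (a : T ⟶ Z) (b : Z ⟶ T) (hab : a ≫ b = 𝟙 T)
    (ha : a ≫ i ≫ sP = j ≫ sX) (hb : b ≫ j ≫ sX = i ≫ sP) :
    ∃ (U : X.Opens), U ≠ ⊥ ∧ ∃ (Y : P.Opens) (a : U.toScheme ⟶ Y.toScheme)
      (b : Y.toScheme ⟶ U.toScheme), a ≫ b = 𝟙 U.toScheme ∧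
        a ≫ Y.ι ≫ sP = U.ι ≫ sX ∧ b ≫ U.ι ≫ sX = Y.ι ≫ sP := by
  refine ⟨j.opensRange, ?_, i.opensRange, j.isoOpensRange.inv ≫ a ≫ i.isoOpensRange.hom,
    i.isoOpensRange.inv ≫ b ≫ j.isoOpensRange.hom, ?_, ?_, ?_⟩
  · obtain ⟨x⟩ := ‹Nonempty T›
    intro h
    have hx : j x ∈ j.opensRange := ⟨x, rfl⟩
    rw [h] at hx
    exact hx
  · simp [reassoc_of% hab]
  · simp [ha]
  · simp [hb]

/-- Retracts of opens of affine space satisfy the lifting property for local `k`-algebras. -/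
theorem exists_lift_of_retract {k A σ : Type} [Field k] [CommRing A] [IsLocalRing A]
    [Algebra k A] {U Z : Scheme} (sU : U ⟶ Spec (CommRingCat.of k))
    (i : Z ⟶ Spec (CommRingCat.of (MvPolynomial σ k))) [IsOpenImmersion i]
    (a : U ⟶ Z) (b : Z ⟶ U) (hab : a ≫ b = 𝟙 U)
    (ha : a ≫ i ≫ Spec.map (CommRingCat.ofHom (algebraMap k (MvPolynomial σ k))) = sU)
    (hb : b ≫ sU = i ≫ Spec.map (CommRingCat.ofHom (algebraMap k (MvPolynomial σ k))))
    (φ : Spec (CommRingCat.of (IsLocalRing.ResidueField A)) ⟶ U)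
    (hφ : φ ≫ sU = Spec.map (CommRingCat.ofHom (algebraMap k (IsLocalRing.ResidueField A)))) :
    ∃ ψ : Spec (CommRingCat.of A) ⟶ U,
      ψ ≫ sU = Spec.map (CommRingCat.ofHom (algebraMap k A)) ∧
      Spec.map (CommRingCat.ofHom (IsLocalRing.residue A)) ≫ ψ = φ := by
  obtain ⟨ψ, hψ, hψφ⟩ := exists_lift_mvPolynomial (A := A) (φ ≫ a ≫ i)
    (by simp only [Category.assoc, ha, hφ])
  have hr := range_subset_of_residue_comp i ψ (φ ≫ a) (by simpa using hψφ)
  refine ⟨IsOpenImmersion.lift i ψ hr ≫ b, ?_, ?_⟩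
  · rw [Category.assoc, hb, IsOpenImmersion.lift_fac_assoc, hψ]
  · have : Spec.map (CommRingCat.ofHom (IsLocalRing.residue A)) ≫ IsOpenImmersion.lift i ψ hr =
        φ ≫ a := by
      rw [← cancel_mono i, Category.assoc, IsOpenImmersion.lift_fac, hψφ, Category.assoc]
    rw [reassoc_of% this, hab, Category.comp_id]

/-- An affine integral scheme of finite type with the lifting property for local `k`-algebras
has a nonempty open subscheme that is a retract of an open of affine space. -/
theorem exists_retract_of_lift {k R : Type} [Field k] [CommRing R] [IsDomain R] [Algebra k R]
    [Algebra.FiniteType k R]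
    (H : ∀ (A : Type) [CommRing A] [IsLocalRing A] [Algebra k A]
      (e : R →ₐ[k] IsLocalRing.ResidueField A),
      ∃ s : R →ₐ[k] A, (IsLocalRing.residue A).comp s.toRingHom = e.toRingHom) :
    ∃ (n : ℕ) (T Z : Scheme) (_ : Nonempty T) (j : T ⟶ Spec (CommRingCat.of R))
      (i : Z ⟶ Spec (CommRingCat.of (MvPolynomial (Fin n) k)))
      (_ : IsOpenImmersion j) (_ : IsOpenImmersion i) (a : T ⟶ Z) (b : Z ⟶ T),
      a ≫ b = 𝟙 T ∧
      a ≫ i ≫ Spec.map (CommRingCat.ofHom (algebraMap k (MvPolynomial (Fin n) k))) =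
        j ≫ Spec.map (CommRingCat.ofHom (algebraMap k R)) ∧
      b ≫ j ≫ Spec.map (CommRingCat.ofHom (algebraMap k R)) =
        i ≫ Spec.map (CommRingCat.ofHom (algebraMap k (MvPolynomial (Fin n) k))) := by
  obtain ⟨n, π, hπ⟩ := Algebra.FiniteType.iff_quotient_mvPolynomial''.1
    (inferInstance : Algebra.FiniteType k R)
  let I : Ideal (MvPolynomial (Fin n) k) := RingHom.ker π
  have : I.IsPrime := RingHom.ker_isPrime π
  let q : (MvPolynomial (Fin n) k ⧸ I) →ₐ[k] I.ResidueField :=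
    Ideal.Quotient.liftₐ I (IsScalarTower.toAlgHom k (MvPolynomial (Fin n) k) I.ResidueField)
      fun _ ↦ Ideal.algebraMap_residueField_eq_zero.mpr
  let e : R →ₐ[k] I.ResidueField :=
    q.comp (Ideal.quotientKerAlgEquivOfSurjective hπ).symm.toAlgHom
  have he (p) : e (π p) = algebraMap _ I.ResidueField p := by
    have : (Ideal.quotientKerAlgEquivOfSurjective hπ).symm (π p) = Ideal.Quotient.mk I p := by
      rw [AlgEquiv.symm_apply_eq]
      rfl
    exact congrArg q this
  obtain ⟨s, hs⟩ := H (Localization.AtPrime I) e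
  obtain ⟨f, t, hf, ht⟩ := exists_away_lift π I rfl hπ e.toRingHom (RingHom.ext he) s hs
  let ρ : Localization.Away f →+* Localization.Away (π f) :=
    IsLocalization.Away.map _ _ π.toRingHom f
  let u : Spec (CommRingCat.of (Localization.Away (π f))) ⟶ Spec (CommRingCat.of R) :=
    Spec.map (CommRingCat.ofHom (algebraMap R _))
  let v : Spec (CommRingCat.of (Localization.Away f)) ⟶
      Spec (CommRingCat.of (MvPolynomial (Fin n) k)) :=
    Spec.map (CommRingCat.ofHom (algebraMap _ _))
  let β : Spec (CommRingCat.of (Localization.Away f)) ⟶ Spec (CommRingCat.of R) :=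
    Spec.map (CommRingCat.ofHom t.toRingHom)
  let α : Spec (CommRingCat.of (Localization.Away (π f))) ⟶
      Spec (CommRingCat.of (Localization.Away f)) := Spec.map (CommRingCat.ofHom ρ)
  have hu : IsOpenImmersion u := inferInstanceAs
    (IsOpenImmersion (Spec.map (CommRingCat.ofHom (algebraMap R (Localization.Away (π f))))))
  have hv : IsOpenImmersion v := inferInstanceAs
    (IsOpenImmersion (Spec.map (CommRingCat.ofHom
      (algebraMap (MvPolynomial (Fin n) k) (Localization.Away f)))))
  have hαβ : α ≫ β = u := by
    simp only [α, β, u, ← Spec.map_comp, ← CommRingCat.ofHom_comp]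
    rw [ht]
  have hvk : v ≫ Spec.map (CommRingCat.ofHom (algebraMap k (MvPolynomial (Fin n) k))) =
      Spec.map (CommRingCat.ofHom (algebraMap k (Localization.Away f))) := by
    simp only [v, ← Spec.map_comp, ← CommRingCat.ofHom_comp]
  have hβk : β ≫ Spec.map (CommRingCat.ofHom (algebraMap k R)) =
      Spec.map (CommRingCat.ofHom (algebraMap k (Localization.Away f))) := by
    simp only [β, ← Spec.map_comp, ← CommRingCat.ofHom_comp]
    congr 2
    exact t.comp_algebraMap
  have : IsDomain (Localization.Away (π f)) :=
    IsLocalization.isDomain_localization (powers_le_nonZeroDivisors_of_noZeroDivisors hf)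
  refine ⟨n, _, Limits.pullback β u, inferInstance, u, Limits.pullback.fst β u ≫ v, hu,
    inferInstance, Limits.pullback.lift α (𝟙 _) (by simp [hαβ]), Limits.pullback.snd β u,
    ?_, ?_, ?_⟩
  · exact Limits.pullback.lift_snd _ _ _
  · rw [Category.assoc, Limits.pullback.lift_fst_assoc, hvk, ← hβk, reassoc_of% hαβ]
  · rw [← Limits.pullback.condition_assoc, hβk, Category.assoc, hvk]

/-- **Saltman's characterization of retract rationality.**
Let `k` be a field of characteristic zero and `X` an integral variety over `k`
(an integral scheme `X` with a locally of finite type structure morphism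
`sX : X ⟶ Spec k`).  The following are equivalent:
(i) there are a nonempty open `U ⊆ X`, an `n`, a nonempty open `Y ⊆ 𝔸ⁿ_k`, and
`k`-morphisms `U → Y → U` composing to the identity of `U`;
(ii) there is a nonempty open `V ⊆ X` such that for every local `k`-algebra `A` with
residue field `κ`, every `k`-point `Spec κ → V` lifts to a `k`-point `Spec A → V`. -/
theorem retract_rational_iff_local_lifting
    (k : Type) [Field k] [CharZero k]
    (X : Scheme) [IsIntegral X]
    (sX : X ⟶ Spec (CommRingCat.of k)) [LocallyOfFiniteType sX] [QuasiCompact sX] :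
    (∃ (U : X.Opens), U ≠ ⊥ ∧
      ∃ (n : ℕ) (Y : (Spec (CommRingCat.of (MvPolynomial (Fin n) k))).Opens)
        (a : U.toScheme ⟶ Y.toScheme) (b : Y.toScheme ⟶ U.toScheme),
        a ≫ b = 𝟙 U.toScheme ∧
        a ≫ Y.ι ≫ Spec.map (CommRingCat.ofHom (algebraMap k (MvPolynomial (Fin n) k))) =
          U.ι ≫ sX ∧
        b ≫ U.ι ≫ sX =
          Y.ι ≫ Spec.map (CommRingCat.ofHom (algebraMap k (MvPolynomial (Fin n) k)))) ↔
    (∃ (V : X.Opens), V ≠ ⊥ ∧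
      ∀ (A : Type) (_ : CommRing A) (_ : IsLocalRing A) (_ : Algebra k A)
        (φ : Spec (CommRingCat.of (IsLocalRing.ResidueField A)) ⟶ V.toScheme),
        φ ≫ V.ι ≫ sX =
            Spec.map (CommRingCat.ofHom (algebraMap k (IsLocalRing.ResidueField A))) →
        ∃ ψ : Spec (CommRingCat.of A) ⟶ V.toScheme,
          ψ ≫ V.ι ≫ sX = Spec.map (CommRingCat.ofHom (algebraMap k A)) ∧
          Spec.map (CommRingCat.ofHom (IsLocalRing.residue A)) ≫ ψ = φ) := by
  constructor
  · rintro ⟨U, hU, n, Y, a, b, hab, ha, hb⟩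
    refine ⟨U, hU, fun A _ _ _ φ hφ => ?_⟩
    exact exists_lift_of_retract (U.ι ≫ sX) Y.ι a b hab ha hb φ hφ
  · rintro ⟨V, hV, H⟩
    obtain ⟨x, hx⟩ : ∃ x, x ∈ V := by
      by_contra! h
      exact hV (TopologicalSpace.Opens.ext (Set.eq_empty_of_forall_notMem h))
    obtain ⟨R, j, hj, ⟨y, hy⟩, -⟩ := V.toScheme.exists_affine_mem_range_and_range_subset
      (x := ⟨x, hx⟩) (U := ⊤) trivial
    have : Nonempty (Spec R) := ⟨y⟩
    have : IsIntegral (Spec R) := isIntegral_of_isOpenImmersion (j ≫ V.ι)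
    have : IsDomain R := (affine_isIntegral_iff R).1 this
    obtain ⟨g, hg⟩ := Spec.map_surjective (j ≫ V.ι ≫ sX)
    algebraize [g.hom]
    have hgk : Spec.map (CommRingCat.ofHom (algebraMap k R)) = j ≫ V.ι ≫ sX := hg
    have : Algebra.FiniteType k R := by
      have : LocallyOfFiniteType (Spec.map g) := by rw [hg]; infer_instance
      exact HasRingHomProperty.Spec_iff.mp this
    obtain ⟨n, T, Z, _, u, i, _, _, a, b, hab, ha, hb⟩ := exists_retract_of_lift (k := k) (R := R)
      fun A _ _ _ e => by
        have hφ : Spec.map (CommRingCat.ofHom e.toRingHom) ≫ j ≫ V.ι ≫ sX =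
            Spec.map (CommRingCat.ofHom (algebraMap k (IsLocalRing.ResidueField A))) := by
          rw [← hgk, ← Spec.map_comp, ← CommRingCat.ofHom_comp]
          congr 2
          exact e.comp_algebraMap
        obtain ⟨ψ, hψ, hψφ⟩ := H A _ _ _ (Spec.map (CommRingCat.ofHom e.toRingHom) ≫ j)
          (by rw [Category.assoc, hφ])
        have hr := range_subset_of_residue_comp j ψ _ hψφ
        obtain ⟨s, hs⟩ := Spec.map_surjective (IsOpenImmersion.lift j ψ hr)
        have hsj : Spec.map s ≫ j = ψ := by rw [hs, IsOpenImmersion.lift_fac]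
        have hsk : CommRingCat.ofHom (algebraMap k R) ≫ s =
            CommRingCat.ofHom (algebraMap k A) := by
          apply Spec.map_injective
          rw [Spec.map_comp, hgk, reassoc_of% hsj, hψ]
        have hse : s ≫ CommRingCat.ofHom (IsLocalRing.residue A) =
            CommRingCat.ofHom e.toRingHom := by
          apply Spec.map_injective
          rw [← cancel_mono j, Spec.map_comp, Category.assoc, hsj, hψφ]
        exact ⟨{ s.hom with
          commutes' := RingHom.congr_fun (congrArg CommRingCat.Hom.hom hsk) },
          congrArg CommRingCat.Hom.hom hse⟩
    rw [hgk] at ha hb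
    obtain ⟨U, hU, Y, h⟩ := exists_retract_of_isOpenImmersion sX _ (u ≫ j ≫ V.ι) i a b hab
      (by simpa using ha) (by simpa using hb)
    exact ⟨U, hU, n, Y, h⟩
end

section
/- Let k be an algebraically closed field of characteristic zero and let A be an integral finitely generated k-algebra which is a unique factorization domain and whose group of units equals k^× (the nonzero constants). Let K = Frac(A) and let a group G act on A by k-algebra automorphisms (extending uniquely to K). Then there exists a nonzero element g ∈ A such that: for every σ ∈ G one has σ(g) = c_σ·g for some scalar c_σ ∈ k^× (so the localization A[1/g] is G-stable), and the fixed field K^G is the field of fractions of the fixed ring (A[1/g])^G, i.e. every G-invariant element of K is a ratio of two G-invariant elements of A[1/g]. -/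
open scoped TensorProduct

/-- If `x ⊗ 1 = 1 ⊗ x` in `E ⊗[F] E`, then `x` lies in the base field `F`. -/
theorem mem_range_algebraMap_of_tmul_one_eq {F E : Type*} [Field F] [Field E] [Algebra F E]
    {x : E} (h : x ⊗ₜ[F] (1 : E) = (1 : E) ⊗ₜ[F] x) : x ∈ Set.range (algebraMap F E) := by
  by_contra hx
  have hx' : x ∉ Submodule.span F {(1 : E)} := by
    rw [Submodule.mem_span_singleton]
    rintro ⟨c, hc⟩
    exact hx ⟨c, by rw [Algebra.algebraMap_eq_smul_one, hc]⟩
  obtain ⟨φ, hφx, hφ⟩ := Submodule.exists_le_ker_of_notMem hx'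
  have hφ1 : φ 1 = 0 := hφ (Submodule.mem_span_singleton_self _)
  have := congrArg (fun t => TensorProduct.lid F E (φ.rTensor E t)) h
  simp [hφ1] at this
  exact hφx this

/-- A subextension of a finitely generated field extension is finitely generated. -/
theorem IntermediateField.fg_of_essFiniteType {F E : Type*} [Field F] [Field E] [Algebra F E]
    [Algebra.EssFiniteType F E] (L : IntermediateField F E) : L.FG := by
  have : IsNoetherianRing (E ⊗[F] E) := Algebra.EssFiniteType.isNoetherianRing E (E ⊗[F] E)
  let d : E → E ⊗[F] E := fun x => x ⊗ₜ 1 - 1 ⊗ₜ x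
  obtain ⟨t, htL, ht⟩ := (Submodule.fg_span_iff_fg_span_finset_subset (R := E ⊗[F] E)
    (d '' (L : Set E))).1 (IsNoetherian.noetherian _)
  classical
  obtain ⟨s, hsL, rfl⟩ := Finset.subset_set_image_iff.1 htL
  refine ⟨s, le_antisymm (IntermediateField.adjoin_le_iff.2 hsL) fun x hx => ?_⟩
  let M := IntermediateField.adjoin F (s : Set E)
  let π : E ⊗[F] E →ₐ[F] E ⊗[M] E :=
    Algebra.TensorProduct.lift
      ((Algebra.TensorProduct.includeLeft : E →ₐ[M] E ⊗[M] E).restrictScalars F)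
      ((Algebra.TensorProduct.includeRight : E →ₐ[M] E ⊗[M] E).restrictScalars F)
      fun _ _ => Commute.all _ _
  have hπ : ∀ y, π (d y) = y ⊗ₜ 1 - 1 ⊗ₜ y := fun y => by simp [π, d]
  have hker : Ideal.span (d '' (L : Set E)) ≤ RingHom.ker π := by
    change Submodule.span _ _ ≤ _
    rw [ht]
    refine Ideal.span_le.2 ?_
    intro z hz
    obtain ⟨y, hy, rfl⟩ := Finset.mem_image.1 (Finset.mem_coe.1 hz)
    rw [SetLike.mem_coe, RingHom.mem_ker, hπ, sub_eq_zero]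
    let y' : M := ⟨y, IntermediateField.subset_adjoin F _ hy⟩
    have : y = y' • (1 : E) := by simp [y', IntermediateField.smul_def]
    rw [this, TensorProduct.smul_tmul]
  have hx0 := hker (Ideal.subset_span ⟨x, hx, rfl⟩)
  rw [RingHom.mem_ker, hπ, sub_eq_zero] at hx0
  obtain ⟨y, rfl⟩ := mem_range_algebraMap_of_tmul_one_eq hx0
  exact y.2

/-- If `σ` fixes a fraction `a / b` in lowest terms, then `σ b` is associated to `b`. -/
theorem IsRelPrime.associated_map_of_mul_eq {A : Type*} [CommRing A] [IsDomain A]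
    [UniqueFactorizationMonoid A] {a b : A} (h : IsRelPrime a b) (σ : A ≃+* A)
    (hσ : σ a * b = a * σ b) : Associated b (σ b) := by
  have h' : IsRelPrime (σ a) (σ b) := fun d hda hdb => by
    have hd : IsUnit (σ.symm d) :=
      h (by simpa using map_dvd σ.symm hda) (by simpa using map_dvd σ.symm hdb)
    simpa using hd
  exact associated_of_dvd_dvd (h.symm.dvd_of_dvd_mul_left (Dvd.intro_left _ hσ))
    (h'.symm.dvd_of_dvd_mul_left (Dvd.intro_left _ hσ.symm))


/-- Let `k` be an algebraically closed field of characteristic zero,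
`A` an integral finitely generated `k`-algebra which is a UFD with `Aˣ = kˣ`, and
`K = Frac(A)`.  Let a group `G` act on `A` by `k`-algebra automorphisms, with induced
action `aK` on `K`.  Then there is a nonzero `g ∈ A` which is a semi-invariant
(`σ • g = c_σ · g` with `c_σ ∈ k`, so the localization `A[1/g]` is `G`-stable), such
that every `G`-invariant element of `K` is a ratio of two `G`-invariant elements of
`A[1/g]` (i.e. of elements of the form `p / gˢ`). -/
theorem invariant_field_is_fraction_field_of_invariants_of_localization
    (k : Type*) [Field k] [IsAlgClosed k] [CharZero k]
    (A : Type*) [CommRing A] [IsDomain A] [Algebra k A] [Algebra.FiniteType k A]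
    [UniqueFactorizationMonoid A]
    (hunits : ∀ u : Aˣ, ∃ c : k, (u : A) = algebraMap k A c)
    (G : Type*) [Group G] [MulSemiringAction G A]
    (halg : ∀ (σ : G) (c : k), σ • (algebraMap k A c) = algebraMap k A c)
    (K : Type*) [Field K] [Algebra A K] [IsFractionRing A K]
    (aK : G →* (K ≃+* K))
    (haK : ∀ (σ : G) (x : A), aK σ (algebraMap A K x) = algebraMap A K (σ • x)) :
    ∃ g : A, g ≠ 0 ∧
      (∀ σ : G, ∃ c : k, σ • g = algebraMap k A c * g) ∧
      ∀ f : K, (∀ σ : G, aK σ f = f) →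
        ∃ (p q : A) (s t : ℕ),
          (algebraMap A K q) / (algebraMap A K g) ^ t ≠ 0 ∧
          (∀ σ : G, aK σ ((algebraMap A K p) / (algebraMap A K g) ^ s) =
            (algebraMap A K p) / (algebraMap A K g) ^ s) ∧
          (∀ σ : G, aK σ ((algebraMap A K q) / (algebraMap A K g) ^ t) =
            (algebraMap A K q) / (algebraMap A K g) ^ t) ∧
          f = ((algebraMap A K p) / (algebraMap A K g) ^ s) /
              ((algebraMap A K q) / (algebraMap A K g) ^ t) := by
  classical
  let : Algebra k K := ((algebraMap A K).comp (algebraMap k A)).toAlgebra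
  have : IsScalarTower k A K := IsScalarTower.of_algebraMap_eq fun _ => rfl
  have : Algebra.EssFiniteType A K := .of_isLocalization K (nonZeroDivisors A)
  have : Algebra.EssFiniteType k K := .comp k A K
  let L : IntermediateField k K :=
    { carrier := {f | ∀ σ : G, aK σ f = f}
      mul_mem' := fun hx hy σ => by rw [map_mul, hx σ, hy σ]
      add_mem' := fun hx hy σ => by rw [map_add, hx σ, hy σ]
      algebraMap_mem' := fun c σ => by
        rw [IsScalarTower.algebraMap_apply k A K, haK, halg]
      inv_mem' := fun x hx σ => by rw [map_inv₀, hx σ] }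
  obtain ⟨S, hS⟩ := L.fg_of_essFiniteType
  have hfrac : ∀ f ∈ L, ∃ a b : A, b ≠ 0 ∧ f * algebraMap A K b = algebraMap A K a ∧
      ∀ σ : G, ∃ c : k, σ • b = algebraMap k A c * b := by
    intro f hf
    obtain ⟨a, b, hab, rfl⟩ := IsFractionRing.exists_reduced_fraction (A := A) f
    have hmul := IsLocalization.mk'_spec K a b
    refine ⟨a, b, nonZeroDivisors.ne_zero b.2, hmul, fun σ => ?_⟩
    have hσ := congrArg (aK σ) hmul
    rw [map_mul, hf σ, haK, haK] at hσ
    have hσ' : (σ • a) * b = a * (σ • (b : A)) := by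
      apply IsFractionRing.injective A K
      rw [map_mul, map_mul, ← hσ, ← hmul]
      ring
    obtain ⟨u, hu⟩ := hab.associated_map_of_mul_eq (MulSemiringAction.toRingEquiv G A σ) hσ'
    obtain ⟨c, hc⟩ := hunits u
    exact ⟨c, by rw [← hc, mul_comm]; exact hu.symm⟩
  choose! a b hb0 hab hbσ using hfrac
  have hSL : ∀ f ∈ S, f ∈ L := fun f hf => hS ▸ IntermediateField.subset_adjoin k _ hf
  let g : A := ∏ f ∈ S, b f
  have hg0 : g ≠ 0 := Finset.prod_ne_zero_iff.2 fun f hf => hb0 f (hSL f hf)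
  have hgK : algebraMap A K g ≠ 0 := by
    rwa [Ne, IsFractionRing.to_map_eq_zero_iff]
  have hadj : ∀ x ∈ Algebra.adjoin k (S : Set K),
      ∃ (p : A) (s : ℕ), x = algebraMap A K p / algebraMap A K g ^ s := by
    intro x hx
    induction hx using Algebra.adjoin_induction with
    | mem f hf =>
      refine ⟨a f * ∏ e ∈ S.erase f, b e, 1, ?_⟩
      rw [pow_one, eq_div_iff hgK, map_mul, ← hab f (hSL f hf), mul_assoc, ← map_mul,
        Finset.mul_prod_erase S b hf]
    | algebraMap c => exact ⟨algebraMap k A c, 0, by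
        rw [pow_zero, div_one, ← IsScalarTower.algebraMap_apply]⟩
    | add x y _ _ hx hy =>
      obtain ⟨p, s, rfl⟩ := hx
      obtain ⟨q, t, rfl⟩ := hy
      exact ⟨p * g ^ t + g ^ s * q, s + t, by
        rw [div_add_div _ _ (pow_ne_zero _ hgK) (pow_ne_zero _ hgK), pow_add]; simp⟩
    | mul x y _ _ hx hy =>
      obtain ⟨p, s, rfl⟩ := hx
      obtain ⟨q, t, rfl⟩ := hy
      exact ⟨p * q, s + t, by rw [div_mul_div_comm, pow_add, map_mul]⟩
  have hinv : Algebra.adjoin k (S : Set K) ≤ L.toSubalgebra := Algebra.adjoin_le hSL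
  refine ⟨g, hg0, fun σ => ?_, fun f hf => ?_⟩
  · choose! c hc using fun f hf => hbσ f hf σ
    refine ⟨∏ f ∈ S, c f, ?_⟩
    rw [Finset.smul_prod', map_prod, ← Finset.prod_mul_distrib]
    exact Finset.prod_congr rfl fun f hf => hc f (hSL f hf)
  · have hfL : f ∈ IntermediateField.adjoin k (S : Set K) := by rw [hS]; exact hf
    obtain ⟨x, hx, y, hy, hxy⟩ := IntermediateField.mem_adjoin_iff_div.1 hfL
    obtain ⟨x, hx, y, hy, hy0, rfl⟩ : ∃ x ∈ Algebra.adjoin k (S : Set K),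
        ∃ y ∈ Algebra.adjoin k (S : Set K), y ≠ 0 ∧ f = x / y := by
      by_cases hy0 : y = 0
      · exact ⟨0, zero_mem _, 1, one_mem _, one_ne_zero, by simp [hxy, hy0]⟩
      · exact ⟨x, hx, y, hy, hy0, hxy⟩
    obtain ⟨p, s, rfl⟩ := hadj x hx
    obtain ⟨q, t, rfl⟩ := hadj y hy
    exact ⟨p, q, s, t, hy0, hinv hx, hinv hy, rfl⟩
end
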